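/- arXiv:0906.4001 — 10 statements merged into one kernel-verified Lean document; each statement's English description precedes it below -/
import Mathlib

section
/- Let X be a nonempty compact topological space, T : X → X a continuous map, and μ a T-invariant Borel probability measure on X. Then for every continuous function f : X → ℝ there exists a point x ∈ X such that for every natural number N ≥ 1, ∑_{i=0}^{N-1} f(T^i x) ≥ N · ∫_X f dμ. -/
open MeasureTheory

/-- The running minimum of the Birkhoff sums of `g` over times `0, …, k`. -/
noncomputable def runMin {X : Type*} (T : X → X) (g : X → ℝ) : ℕ → X → ℝ
  | 0 => fun _ => 0
  | k + 1 => fun x => min 0 (g x + runMin T g k (T x))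

theorem runMin_continuous {X : Type*} [TopologicalSpace X] {T : X → X} (hT : Continuous T)
    {g : X → ℝ} (hg : Continuous g) (k : ℕ) : Continuous (runMin T g k) := by
  induction k with
  | zero => exact continuous_const
  | succ k ih => exact continuous_const.min (hg.add (ih.comp hT))

theorem runMin_succ_le {X : Type*} (T : X → X) (g : X → ℝ) (k : ℕ) :
    ∀ x, runMin T g (k + 1) x ≤ runMin T g k x := by
  induction k with
  | zero => intro x; exact min_le_left _ _
  | succ k ih =>
    intro x
    exact min_le_min le_rfl (add_le_add le_rfl (ih (T x)))

theorem runMin_le_sum {X : Type*} (T : X → X) (g : X → ℝ) (k : ℕ) :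
    ∀ n, n ≤ k → ∀ x, runMin T g k x ≤ ∑ i ∈ Finset.range n, g (T^[i] x) := by
  induction k with
  | zero =>
    intro n hn x
    obtain rfl : n = 0 := by omega
    simp [runMin]
  | succ k ih =>
    intro n hn x
    cases n with
    | zero =>
      rw [Finset.sum_range_zero]
      exact min_le_left _ _
    | succ n =>
      refine (min_le_right _ _).trans ?_
      rw [Finset.sum_range_succ']
      have := ih n (by omega) (T x)
      simp only [Function.iterate_succ_apply, Function.iterate_zero, id]
      linarith

theorem exists_nonneg_sums
    {X : Type*} [TopologicalSpace X] [CompactSpace X]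
    [MeasurableSpace X] [BorelSpace X]
    (T : X → X) (hT : Continuous T)
    (μ : Measure X) [IsProbabilityMeasure μ] (hμ : MeasurePreserving T μ μ)
    (g : X → ℝ) (hg : Continuous g) (hpos : 0 < ∫ y, g y ∂μ) (N : ℕ) :
    ∃ x : X, ∀ n ≤ N, 0 ≤ ∑ i ∈ Finset.range n, g (T^[i] x) := by
  have hint : ∀ h : X → ℝ, Continuous h → Integrable h μ := fun h hh =>
    hh.integrable_of_hasCompactSupport (HasCompactSupport.of_compactSpace h)
  have hM := runMin_continuous hT hg
  by_cases hx : ∃ x, 0 ≤ g x + runMin T g N (T x)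
  · obtain ⟨x, hx⟩ := hx
    refine ⟨x, fun n hn => ?_⟩
    cases n with
    | zero => simp
    | succ n =>
      rw [Finset.sum_range_succ']
      have := runMin_le_sum T g N n (by omega) (T x)
      simp only [Function.iterate_succ_apply, Function.iterate_zero, id]
      linarith
  · exfalso
    push Not at hx
    have h1 : ∀ x, runMin T g (N + 1) x = g x + runMin T g N (T x) :=
      fun x => min_eq_right (hx x).le
    have h2 : ∫ x, runMin T g (N + 1) x ∂μ ≤ ∫ x, runMin T g N x ∂μ :=
      integral_mono (hint _ (hM _)) (hint _ (hM _)) (runMin_succ_le T g N)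
    have h3 : ∫ x, runMin T g N (T x) ∂μ = ∫ x, runMin T g N x ∂μ := by
      conv_rhs => rw [← hμ.map_eq]
      rw [integral_map hμ.aemeasurable]
      exact (hM N).measurable.aestronglyMeasurable
    simp_rw [h1] at h2
    rw [integral_add (hint _ hg) (hint (fun x => runMin T g N (T x)) ((hM N).comp hT)), h3] at h2
    linarith

/-- **Peres' lemma (heavy points).** For a continuous map `T` of a nonempty compact
space preserving a Borel probability measure `μ`, and any continuous `f : X → ℝ`,
there is a point whose Birkhoff sums dominate the expected value at all times. -/
theorem peres_lemma_heavy_point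
    {X : Type*} [TopologicalSpace X] [CompactSpace X] [Nonempty X]
    [MeasurableSpace X] [BorelSpace X]
    (T : X → X) (hT : Continuous T)
    (μ : Measure X) [IsProbabilityMeasure μ] (hμ : MeasurePreserving T μ μ)
    (f : X → ℝ) (hf : Continuous f) :
    ∃ x : X, ∀ N : ℕ, 1 ≤ N →
      (N : ℝ) * ∫ y, f y ∂μ ≤ ∑ i ∈ Finset.range N, f (T^[i] x) := by
  set I := ∫ y, f y ∂μ with hI
  have hfi : Integrable f μ :=
    hf.integrable_of_hasCompactSupport (HasCompactSupport.of_compactSpace f)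
  let K : ℕ → Set X := fun N =>
    {x | ∀ n ≤ N, (n : ℝ) * (I - 1 / ((N : ℝ) + 1)) ≤ ∑ i ∈ Finset.range n, f (T^[i] x)}
  have hclosed : ∀ N, IsClosed (K N) := by
    intro N
    simp only [K, Set.ofPred_forall]
    refine isClosed_iInter fun n => isClosed_iInter fun _ => ?_
    exact isClosed_le continuous_const
      (continuous_finsetSum _ fun i _ => hf.comp (hT.iterate i))
  have hne : ∀ N, (K N).Nonempty := by
    intro N
    have hp : (0 : ℝ) < 1 / ((N : ℝ) + 1) := by positivity
    obtain ⟨x, hx⟩ := exists_nonneg_sums T hT μ hμ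
      (fun y => f y - (I - 1 / ((N : ℝ) + 1))) (hf.sub continuous_const)
      (by
        rw [integral_sub hfi (integrable_const _)]
        simp only [integral_const, probReal_univ, one_smul]
        linarith) N
    refine ⟨x, fun n hn => ?_⟩
    have := hx n hn
    rw [Finset.sum_sub_distrib, Finset.sum_const, Finset.card_range, nsmul_eq_mul] at this
    linarith
  have hmono : ∀ N, K (N + 1) ⊆ K N := by
    intro N x hx n hn
    refine le_trans ?_ (hx n (by omega))
    have : 1 / (((N + 1 : ℕ) : ℝ) + 1) ≤ 1 / ((N : ℝ) + 1) :=
      one_div_le_one_div_of_le (by positivity) (by push_cast; linarith)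
    exact mul_le_mul_of_nonneg_left (by linarith) (Nat.cast_nonneg n)
  obtain ⟨x, hx⟩ := IsCompact.nonempty_iInter_of_sequence_nonempty_isCompact_isClosed K
    hmono hne (hclosed 0).isCompact hclosed
  rw [Set.mem_iInter] at hx
  refine ⟨x, fun n _ => ?_⟩
  have hlim : Filter.Tendsto (fun N : ℕ => (n : ℝ) * (I - 1 / ((N : ℝ) + 1))) Filter.atTop
      (nhds ((n : ℝ) * (I - 0))) :=
    (tendsto_const_nhds.sub tendsto_one_div_add_atTop_nhds_zero_nat).const_mul _
  rw [sub_zero] at hlim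
  refine le_of_tendsto hlim ?_
  filter_upwards [Filter.eventually_ge_atTop n] with N hN
  exact hx N n hN
end

section
/- Let X be a nonempty compact topological space, T : X → X a continuous map, and μ a T-invariant Borel probability measure on X. If f : X → ℝ is upper semicontinuous and integrable with respect to μ, then there exists a point x ∈ X such that for every natural number N ≥ 1, ∑_{i=0}^{N-1} f(T^i x) ≥ N · ∫_X f dμ. -/
open MeasureTheory

/-- `peresMin T g k x` is the minimum of the Birkhoff sums `S_0, ..., S_k` of `g` at `x`. -/
noncomputable def peresMin {X : Type*} (T : X → X) (g : X → ℝ) : ℕ → X → ℝ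
  | 0 => fun _ => 0
  | k + 1 => fun x => min 0 (g x + peresMin T g k (T x))

theorem peresMin_anti {X : Type*} (T : X → X) (g : X → ℝ) (k : ℕ) :
    ∀ x, peresMin T g (k + 1) x ≤ peresMin T g k x := by
  induction k with
  | zero => intro x; exact min_le_left _ _
  | succ k ih =>
    intro x
    exact min_le_min le_rfl (by linarith [ih (T x)])

theorem peresMin_le {X : Type*} (T : X → X) (g : X → ℝ) (k : ℕ) :
    ∀ n ≤ k, ∀ x, peresMin T g k x ≤ ∑ i ∈ Finset.range n, g (T^[i] x) := by
  induction k with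
  | zero =>
    intro n hn x
    obtain rfl : n = 0 := by omega
    simp [peresMin]
  | succ k ih =>
    intro n hn x
    cases n with
    | zero => simp [peresMin]
    | succ n =>
      rw [Finset.sum_range_succ']
      have h := ih n (by omega) (T x)
      have h2 : peresMin T g (k + 1) x ≤ g x + peresMin T g k (T x) := min_le_right _ _
      simp only [Function.iterate_succ_apply, Function.iterate_zero, id]
      linarith

theorem peresMin_integrable {X : Type*} [MeasurableSpace X] (T : X → X) (μ : Measure X)
    (hμ : MeasurePreserving T μ μ) (g : X → ℝ) (hg : Integrable g μ) (k : ℕ) :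
    Integrable (peresMin T g k) μ := by
  induction k with
  | zero => exact integrable_zero _ _ _
  | succ k ih =>
    exact (integrable_zero X ℝ μ).inf (hg.add (hμ.integrable_comp_of_integrable ih))

theorem peres_finite {X : Type*} [MeasurableSpace X] (T : X → X) (μ : Measure X)
    (hμ : MeasurePreserving T μ μ) (g : X → ℝ) (hg : Integrable g μ) (h0 : 0 < ∫ y, g y ∂μ)
    (K : ℕ) : ∃ x, ∀ n ≤ K, 0 ≤ ∑ i ∈ Finset.range n, g (T^[i] x) := by
  by_contra! h
  have hI := peresMin_integrable T μ hμ g hg K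
  have hIT : Integrable (fun x => peresMin T g K (T x)) μ := hμ.integrable_comp_of_integrable hI
  have hle : ∀ x, g x + peresMin T g K (T x) ≤ peresMin T g K x := by
    intro x
    obtain ⟨n, hn, hx⟩ := h x
    have hneg := (peresMin_le T g K n hn x).trans_lt hx
    cases K with
    | zero => simp [peresMin] at hneg
    | succ k =>
      have ha := peresMin_anti T g k (T x)
      have hk : peresMin T g (k + 1) x = min 0 (g x + peresMin T g k (T x)) := rfl
      rcases min_choice 0 (g x + peresMin T g k (T x)) with h | h <;> linarith
  have h1 := integral_mono (hg.add hIT) hI hle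
  have h2 : ∫ x, peresMin T g K (T x) ∂μ = ∫ x, peresMin T g K x ∂μ := by
    have := integral_map (μ := μ) hμ.measurable.aemeasurable (f := peresMin T g K)
      (by rw [hμ.map_eq]; exact hI.aestronglyMeasurable)
    rw [hμ.map_eq] at this
    exact this.symm
  have h3 := integral_add hg hIT
  simp only [Pi.add_apply] at h1
  linarith

/-- Peres' lemma for upper semicontinuous integrable functions. -/
theorem peres_lemma_heavy_point_upperSemicontinuous
    {X : Type*} [TopologicalSpace X] [CompactSpace X] [Nonempty X]
    [MeasurableSpace X] [BorelSpace X]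
    (T : X → X) (hT : Continuous T)
    (μ : Measure X) [IsProbabilityMeasure μ] (hμ : MeasurePreserving T μ μ)
    (f : X → ℝ) (hf : UpperSemicontinuous f) (hfi : Integrable f μ) :
    ∃ x : X, ∀ N : ℕ, 1 ≤ N →
      (N : ℝ) * ∫ y, f y ∂μ ≤ ∑ i ∈ Finset.range N, f (T^[i] x) := by
  set a := ∫ y, f y ∂μ with ha
  let C : ℕ → Set X := fun K => {x | ∀ n ≤ K,
    (n : ℝ) * (a - 1 / ((K : ℝ) + 1)) ≤ ∑ i ∈ Finset.range n, f (T^[i] x)}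
  have husc : ∀ n : ℕ, UpperSemicontinuous fun x => ∑ i ∈ Finset.range n, f (T^[i] x) := by
    intro n
    exact upperSemicontinuous_sum fun i _ => hf.comp (hT.iterate i)
  have hclosed : ∀ K, IsClosed (C K) := by
    intro K
    have : C K = ⋂ n, ⋂ (_ : n ≤ K), (fun x => ∑ i ∈ Finset.range n, f (T^[i] x)) ⁻¹'
        Set.Ici ((n : ℝ) * (a - 1 / ((K : ℝ) + 1))) := by
      ext x; simp [C]
    rw [this]
    exact isClosed_iInter fun n => isClosed_iInter fun _ => (husc n).isClosed_preimage _
  have hne : ∀ K, (C K).Nonempty := by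
    intro K
    have hpos : (0 : ℝ) < 1 / ((K : ℝ) + 1) := by positivity
    obtain ⟨x, hx⟩ := peres_finite T μ hμ (fun y => f y - (a - 1 / ((K : ℝ) + 1)))
      (hfi.sub (integrable_const _)) (by
        rw [integral_sub hfi (integrable_const _)]
        simp only [integral_const, probReal_univ, one_smul]
        linarith) K
    refine ⟨x, fun n hn => ?_⟩
    have := hx n hn
    rw [Finset.sum_sub_distrib, Finset.sum_const, Finset.card_range, nsmul_eq_mul] at this
    linarith
  have hanti : ∀ K, C (K + 1) ⊆ C K := by
    intro K x hx n hn
    refine le_trans ?_ (hx n (by omega))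
    have : 1 / (((K + 1 : ℕ) : ℝ) + 1) ≤ 1 / ((K : ℝ) + 1) := by
      apply one_div_le_one_div_of_le (by positivity)
      push_cast; linarith
    gcongr
  obtain ⟨x, hx⟩ := IsCompact.nonempty_iInter_of_sequence_nonempty_isCompact_isClosed C hanti hne
    (hclosed 0).isCompact hclosed
  refine ⟨x, fun N _ => ?_⟩
  rw [Set.mem_iInter] at hx
  have hlim : Filter.Tendsto (fun K : ℕ => (N : ℝ) * (a - 1 / ((K : ℝ) + 1))) Filter.atTop
      (nhds ((N : ℝ) * (a - 0))) :=
    (tendsto_const_nhds.sub tendsto_one_div_add_atTop_nhds_zero_nat).const_mul _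
  rw [sub_zero] at hlim
  exact le_of_tendsto hlim (Filter.eventually_atTop.2 ⟨N, fun K hK => hx K N hK⟩)
end

section
/- Let X be a nonempty compact topological space, T : X → X a continuous map, and μ a T-invariant Borel probability measure on X. Let A ⊆ X be a closed set. Then there exists a point x ∈ X such that for every natural number N ≥ 1, the number of indices i with 0 ≤ i ≤ N−1 and T^i x ∈ A is at least N · μ(A). -/
open MeasureTheory
open scoped Classical

/-- Number of visits to `A` among the first `N` iterates. -/
noncomputable def visitSum {X : Type*} (T : X → X) (A : Set X) (N : ℕ) (x : X) : ℝ :=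
  ∑ i ∈ Finset.range N, A.indicator (fun _ => (1 : ℝ)) (T^[i] x)

lemma visitSum_eq_card {X : Type*} (T : X → X) (A : Set X) (N : ℕ) (x : X) :
    visitSum T A N x = ((Finset.range N).filter (fun i => T^[i] x ∈ A)).card := by
  simp [visitSum, Set.indicator_apply]

lemma visitSum_add {X : Type*} (T : X → X) (A : Set X) (N K : ℕ) (x : X) :
    visitSum T A (N + K) x = visitSum T A N x + visitSum T A K (T^[N] x) := by
  unfold visitSum
  rw [Finset.sum_range_add]
  congr 1
  refine Finset.sum_congr rfl fun i _ => ?_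
  rw [← Function.iterate_add_apply, add_comm]

lemma visitSum_le {X : Type*} (T : X → X) (A : Set X) (N : ℕ) (x : X) :
    visitSum T A N x ≤ N := by
  rw [visitSum_eq_card]
  exact_mod_cast (Finset.card_filter_le _ _).trans (by simp)

lemma visitSum_closed {X : Type*} [TopologicalSpace X] (T : X → X) (hT : Continuous T)
    (A : Set X) (hA : IsClosed A) (N : ℕ) (r : ℝ) : IsClosed {x | r ≤ visitSum T A N x} := by
  have h : UpperSemicontinuous (fun x => visitSum T A N x) := by
    unfold visitSum
    apply upperSemicontinuous_sum
    intro i _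
    exact (hA.upperSemicontinuous_indicator zero_le_one).comp (hT.iterate i)
  exact upperSemicontinuous_iff_isClosed_preimage.1 h r

lemma visitSum_bound {X : Type*} (T : X → X) (A : Set X) (n : ℕ) (c : ℝ) (hc : 0 ≤ c)
    (h : ∀ x, ∃ N, 1 ≤ N ∧ N ≤ n ∧ visitSum T A N x ≤ N * c) (L : ℕ) :
    ∀ x, visitSum T A L x ≤ L * c + n := by
  induction L using Nat.strong_induction_on with
  | _ L ih =>
    intro x
    by_cases hL : L ≤ n
    · have h1 := visitSum_le T A L x
      have h2 : (L : ℝ) ≤ n := by exact_mod_cast hL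
      have h3 : 0 ≤ (L : ℝ) * c := by positivity
      linarith
    · obtain ⟨N, h1, h2, h3⟩ := h x
      obtain ⟨K, rfl⟩ : ∃ K, L = N + K := ⟨L - N, by omega⟩
      have := ih K (by omega) (T^[N] x)
      rw [visitSum_add]
      push_cast
      linarith

lemma visitSum_integral {X : Type*} [MeasurableSpace X] (T : X → X)
    (μ : Measure X) [IsProbabilityMeasure μ] (hμ : MeasurePreserving T μ μ)
    (A : Set X) (hA : MeasurableSet A) (L : ℕ) :
    Integrable (visitSum T A L) μ ∧ ∫ x, visitSum T A L x ∂μ = L * (μ A).toReal := by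
  have hi : ∀ i, Integrable (fun x => A.indicator (fun _ => (1 : ℝ)) (T^[i] x)) μ := fun i =>
    (hμ.iterate i).integrable_comp_of_integrable ((integrable_const (1 : ℝ)).indicator hA)
  constructor
  · exact integrable_finset_sum _ fun i _ => hi i
  · unfold visitSum
    rw [integral_finset_sum _ fun i _ => hi i]
    have : ∀ i, ∫ x, A.indicator (fun _ => (1 : ℝ)) (T^[i] x) ∂μ = (μ A).toReal := by
      intro i
      have hm : (fun x => A.indicator (fun _ => (1 : ℝ)) (T^[i] x))
          = (T^[i] ⁻¹' A).indicator (fun _ => (1 : ℝ)) := by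
        ext x; simp [Set.indicator_apply]
      have hi' := hμ.iterate i
      rw [hm, integral_indicator (hi'.measurable hA)]
      simp [Measure.real, hi'.measure_preimage hA.nullMeasurableSet]
    simp [this]

/-- Heavy points for a closed set: there is a point whose orbit visits a closed set `A`
at least in proportion `μ A` at every finite time. -/
theorem heavy_point_for_closed_set
    {X : Type*} [TopologicalSpace X] [CompactSpace X] [Nonempty X]
    [MeasurableSpace X] [BorelSpace X]
    (T : X → X) (hT : Continuous T)
    (μ : Measure X) [IsProbabilityMeasure μ] (hμ : MeasurePreserving T μ μ)
    (A : Set X) (hA : IsClosed A) :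
    ∃ x : X, ∀ N : ℕ, 1 ≤ N →
      (N : ℝ) * (μ A).toReal ≤
        ((Finset.range N).filter (fun i => T^[i] x ∈ A)).card := by
  set m := (μ A).toReal with hm
  let F : ℕ → Set X := fun n => ⋂ N ∈ Set.Iic n, {x | (N : ℝ) * m ≤ visitSum T A N x}
  have hFc : ∀ n, IsClosed (F n) := fun n =>
    isClosed_biInter fun N _ => visitSum_closed T hT A hA N _
  have hFne : ∀ n, (F n).Nonempty := by
    intro n
    by_contra hne
    have hlt : ∀ x, ∃ N, 1 ≤ N ∧ N ≤ n ∧ visitSum T A N x < N * m := by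
      intro x
      by_contra! hx
      refine hne ⟨x, ?_⟩
      simp only [F, Set.mem_iInter, Set.mem_Iic, Set.mem_setOf_eq]
      intro N hN
      rcases Nat.eq_zero_or_pos N with rfl | h
      · simp [visitSum]
      · exact hx N h hN
    let R : Finset ℝ := (((Finset.range (n+1)) ×ˢ (Finset.range (n+1))).image
      (fun p : ℕ × ℕ => (p.1 : ℝ) / p.2)).filter (· < m)
    obtain ⟨c, hcR, hcm⟩ : ∃ c, (∀ r ∈ R, r ≤ c) ∧ c < m := by
      have h1 : ∀ᶠ c in nhdsWithin m (Set.Iio m), ∀ r ∈ R, r ≤ c := by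
        rw [Filter.eventually_all_finset]
        intro r hr
        have : r < m := (Finset.mem_filter.1 hr).2
        exact nhdsWithin_le_nhds ((lt_mem_nhds this).mono fun _ h => le_of_lt h)
      exact (h1.and self_mem_nhdsWithin).exists
    have hle : ∀ x, ∃ N, 1 ≤ N ∧ N ≤ n ∧ visitSum T A N x ≤ N * c := by
      intro x
      obtain ⟨N, h1, h2, h3⟩ := hlt x
      refine ⟨N, h1, h2, ?_⟩
      have hN : (0 : ℝ) < N := by exact_mod_cast h1
      have h4 := visitSum_le T A N x
      rw [visitSum_eq_card] at h3 h4 ⊢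
      set j := ((Finset.range N).filter (fun i => T^[i] x ∈ A)).card
      have hj : j ≤ N := by exact_mod_cast h4
      have := hcR ((j : ℝ) / N) (by
        refine Finset.mem_filter.2 ⟨Finset.mem_image.2 ⟨(j, N), ?_, rfl⟩, ?_⟩
        · simp only [Finset.mem_product, Finset.mem_range]; omega
        · rw [div_lt_iff₀ hN]; linarith)
      rw [div_le_iff₀ hN] at this
      linarith
    have hc : 0 ≤ c := by
      obtain ⟨x⟩ := ‹Nonempty X›
      obtain ⟨N, h1, h2, h3⟩ := hle x
      have hN : (0 : ℝ) < N := by exact_mod_cast h1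
      rw [visitSum_eq_card] at h3
      have : (0 : ℝ) ≤ N * c := (Nat.cast_nonneg _).trans h3
      exact nonneg_of_mul_nonneg_right this hN
    obtain ⟨L, hL⟩ := exists_nat_gt ((n : ℝ) / (m - c))
    have hb := visitSum_bound T A n c hc hle L
    obtain ⟨hi, he⟩ := visitSum_integral T μ hμ A hA.measurableSet L
    have := integral_mono hi (integrable_const ((L : ℝ) * c + n)) hb
    rw [he] at this
    simp only [integral_const, probReal_univ, one_smul] at this
    rw [div_lt_iff₀ (by linarith)] at hL
    linarith
  obtain ⟨x, hx⟩ := IsCompact.nonempty_iInter_of_sequence_nonempty_isCompact_isClosed F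
    (fun n => Set.biInter_subset_biInter_left (Set.Iic_subset_Iic.2 n.le_succ))
    hFne (hFc 0).isCompact hFc
  refine ⟨x, fun N _ => ?_⟩
  rw [← visitSum_eq_card]
  have := Set.mem_iInter.1 hx N
  simp only [F, Set.mem_iInter, Set.mem_Iic, Set.mem_setOf_eq] at this
  exact this N le_rfl
end

section
/- Fix a real number α and a natural number k ≥ 1, and let I be a closed subset of the circle ℝ/ℤ with Haar (Lebesgue) probability measure μ. Then there exist real numbers a_0, a_1, …, a_{k−1} such that, writing p(x) = α x^k + a_{k−1} x^{k−1} + ⋯ + a_1 x + a_0, for every natural number N ≥ 1 the number of indices n with 0 ≤ n ≤ N−1 and p(n) mod 1 ∈ I is at least N · μ(I). -/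
open MeasureTheory
open scoped Classical


theorem heavy_finite {X : Type*} [MeasurableSpace X] (μ : Measure X) (T : X → X)
    (hT : MeasurePreserving T μ μ) (g : X → ℝ) (hg : Integrable g μ) (hpos : 0 < ∫ x, g x ∂μ)
    (M : ℕ) : ∃ x, ∀ n ≤ M + 1, 0 ≤ birkhoffSum T g n x := by
  obtain ⟨F, hF0, hFs⟩ : ∃ F : ℕ → X → ℝ, F 0 = (fun _ => 0) ∧
      ∀ m, F (m+1) = fun x => min 0 (g x + F m (T x)) :=
    ⟨fun m => Nat.rec (fun _ => 0) (fun _ f x => min 0 (g x + f (T x))) m, rfl, fun _ => rfl⟩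
  have hint : ∀ m, Integrable (F m) μ := by
    intro m
    induction m with
    | zero => rw [hF0]; exact integrable_zero _ _ _
    | succ m ih =>
      rw [hFs]
      exact (integrable_zero X ℝ μ).inf (hg.add (hT.integrable_comp_of_integrable ih))
  have hanti : ∀ m x, F (m+1) x ≤ F m x := by
    intro m
    induction m with
    | zero => intro x; rw [hFs, hF0]; exact min_le_left _ _
    | succ m ih =>
      intro x; rw [hFs (m+1), hFs m]
      have := ih (T x)
      rw [hFs m] at this
      exact min_le_min le_rfl (by linarith)
  have hle : ∀ m x, ∀ n ≤ m, F m x ≤ birkhoffSum T g n x := by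
    intro m
    induction m with
    | zero => intro x n hn; obtain rfl : n = 0 := by omega
              simp [hF0]
    | succ m ih =>
      intro x n hn
      rw [hFs]
      cases n with
      | zero => simp
      | succ n =>
        rw [birkhoffSum_succ']
        have := ih (T x) n (by omega)
        exact (min_le_right _ _).trans (by linarith)
  by_contra! hcon
  have key : ∀ x, g x + F (M+1) (T x) ≤ F (M+1) x := by
    intro x
    obtain ⟨n, hn, hlt⟩ := hcon x
    have h1 := (hle (M+1) x n hn).trans_lt hlt
    have h2 := hanti M (T x)
    rw [hFs M] at h1
    have h3 : F (M+1) x = g x + F M (T x) := by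
      rw [hFs M]
      simp only at h1 ⊢
      rcases min_lt_iff.1 h1 with h | h
      · exact absurd h (lt_irrefl _)
      · exact min_eq_right h.le
    linarith
  have hcomp : Integrable (fun x => F (M+1) (T x)) μ := hT.integrable_comp_of_integrable (hint _)
  have h := integral_mono (hg.add hcomp) (hint (M+1)) key
  have h2 : ∫ x, (g + fun x => F (M+1) (T x)) x ∂μ = ∫ x, g x ∂μ + ∫ x, F (M+1) (T x) ∂μ :=
    integral_add hg hcomp
  have h3 : ∫ x, F (M+1) (T x) ∂μ = ∫ x, F (M+1) x ∂μ := by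
    have := integral_map (μ := μ) (φ := T) (f := F (M+1)) hT.measurable.aemeasurable
      (by rw [hT.map_eq]; exact (hint _).aestronglyMeasurable)
    rw [← this, hT.map_eq]
  rw [h2, h3] at h
  linarith

theorem heavy_exists {X : Type*} [MeasurableSpace X] [TopologicalSpace X] [CompactSpace X]
    [BorelSpace X] (μ : Measure X) [IsProbabilityMeasure μ] (T : X → X)
    (hc : Continuous T)
    (hT : MeasurePreserving T μ μ) (J : Set X) (hJ : IsClosed J) :
    ∃ x, ∀ n : ℕ, (n:ℝ) * μ.real J ≤ birkhoffSum T (J.indicator (fun _ => (1:ℝ))) n x := by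
  set f : X → ℝ := J.indicator (fun _ => (1:ℝ)) with hf
  set c := μ.real J with hcdef
  have husc : ∀ n, UpperSemicontinuous (birkhoffSum T f n) := by
    intro n
    have : birkhoffSum T f n = fun x => ∑ i ∈ Finset.range n, f (T^[i] x) := rfl
    rw [this]
    refine upperSemicontinuous_sum fun i _ => ?_
    exact (hJ.upperSemicontinuous_indicator zero_le_one).comp (hc.iterate i)
  have hint : Integrable f μ := (integrable_const (1:ℝ)).indicator hJ.measurableSet
  have hfi : ∫ x, f x ∂μ = c := by
    exact integral_indicator_one hJ.measurableSet
  let K : ℕ → Set X := fun j => ⋂ n ∈ Finset.range (j+2), {x | (n:ℝ) * (c - 1/((j:ℝ)+1)) ≤ birkhoffSum T f n x}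
  have hcl : ∀ j, IsClosed (K j) := fun j =>
    isClosed_biInter fun n _ => (husc n).isClosed_preimage _
  have hne : ∀ j, (K j).Nonempty := by
    intro j
    have hp : (0:ℝ) < 1/((j:ℝ)+1) := by positivity
    obtain ⟨x, hx⟩ := heavy_finite μ T hT (fun x => f x - (c - 1/((j:ℝ)+1)))
      (hint.sub (integrable_const _)) (by
        rw [integral_sub hint (integrable_const _), hfi]; simp; positivity) j
    refine ⟨x, Set.mem_iInter₂.2 fun n hn => ?_⟩
    have := hx n (by simp at hn; omega)
    simp only [birkhoffSum, Finset.sum_sub_distrib, Finset.sum_const, Finset.card_range, nsmul_eq_mul] at this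
    simp only [birkhoffSum, Set.mem_ofPred_eq]
    linarith
  obtain ⟨x, hx⟩ := IsCompact.nonempty_iInter_of_sequence_nonempty_isCompact_isClosed K (by
    intro j x hx
    refine Set.mem_iInter₂.2 fun n hn => ?_
    have h1 := Set.mem_iInter₂.1 hx n (by simp at hn ⊢; omega)
    rw [Set.mem_ofPred_eq] at h1 ⊢
    refine le_trans ?_ h1
    have : 1/(((j+1:ℕ):ℝ)+1) ≤ 1/((j:ℝ)+1) := by
      apply one_div_le_one_div_of_le (by positivity); push_cast; linarith
    gcongr) hne (hcl 0).isCompact hcl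
  refine ⟨x, fun n => ?_⟩
  have ht : Filter.Tendsto (fun j : ℕ => (n:ℝ) * (c - 1/((j:ℝ)+1))) Filter.atTop (nhds ((n:ℝ) * (c - 0))) :=
    (tendsto_const_nhds.sub tendsto_one_div_add_atTop_nhds_zero_nat).const_mul _
  rw [sub_zero] at ht
  refine le_of_tendsto ht (Filter.eventually_atTop.2 ⟨n, fun j hj => ?_⟩)
  exact Set.mem_iInter₂.1 (Set.mem_iInter.1 hx j) n (by simp; omega)

theorem binom_fin (n k j : ℕ) (hj : j < k) : ∑ i : Fin k, n ^ (i:ℕ) * j.choose i = (n+1)^j := by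
  rw [Fin.sum_univ_eq_sum_range (fun i => n ^ i * j.choose i) k, add_pow]
  symm
  simp only [one_pow, mul_one]
  apply Finset.sum_subset
  · intro i; simp; omega
  · intro i _ hi
    simp [Nat.choose_eq_zero_of_lt (show j < i by simp at hi; omega)]

theorem binom_fin' (n k : ℕ) : n ^ k + ∑ i : Fin k, n ^ (i:ℕ) * k.choose i = (n+1)^k := by
  rw [Fin.sum_univ_eq_sum_range (fun i => n ^ i * k.choose i) k, add_pow, Finset.sum_range_succ]
  simp [add_comm]

/-- The linear part of the shift on coefficients. -/
def shiftHom (k : ℕ) : (Fin k → UnitAddCircle) →+ (Fin k → UnitAddCircle) where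
  toFun a i := ∑ j : Fin k, (j:ℕ).choose i • a j
  map_zero' := by ext i; simp
  map_add' a b := by ext i; simp [Finset.sum_add_distrib]

theorem shiftHom_surjective (k : ℕ) : Function.Surjective (shiftHom k) := by
  let A : Matrix (Fin k) (Fin k) ℤ := Matrix.of fun i j => ((j:ℕ).choose i : ℤ)
  have hdet : A.det = 1 := by
    rw [Matrix.det_of_isUpperTriangular]
    · simp [A]
    · intro i j hij
      simp only [A, Matrix.of_apply]
      exact_mod_cast Nat.choose_eq_zero_of_lt hij
  have hAA : A * A⁻¹ = 1 := Matrix.mul_nonsing_inv _ (by rw [hdet]; exact isUnit_one)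
  intro b
  refine ⟨fun j => ∑ l, A⁻¹ j l • b l, ?_⟩
  ext i
  have h1 : ∀ j : Fin k, ∀ y : UnitAddCircle, (j:ℕ).choose i • y = A i j • y := by
    intro j y; simp [A]
  simp only [shiftHom, AddMonoidHom.coe_mk, ZeroHom.coe_mk, h1, Finset.smul_sum, smul_smul]
  rw [Finset.sum_comm]
  simp only [← Finset.sum_smul, ← Matrix.mul_apply, hAA]
  simp [Matrix.one_apply]

/-- Value at `n` of the polynomial with coefficients in the circle. -/
def polyVal (k : ℕ) (α : UnitAddCircle) (a : Fin k → UnitAddCircle) (n : ℕ) : UnitAddCircle :=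
  n ^ k • α + ∑ j : Fin k, n ^ (j:ℕ) • a j

/-- The shift on coefficients. -/
def shiftMap (k : ℕ) (α : UnitAddCircle) (a : Fin k → UnitAddCircle) : Fin k → UnitAddCircle :=
  shiftHom k a + fun i : Fin k => k.choose (i:ℕ) • α

theorem polyVal_shift (k : ℕ) (α : UnitAddCircle) (a : Fin k → UnitAddCircle) (n : ℕ) :
    polyVal k α (shiftMap k α a) n = polyVal k α a (n+1) := by
  simp only [polyVal, shiftMap, shiftHom, AddMonoidHom.coe_mk, ZeroHom.coe_mk, Pi.add_apply,
    smul_add, Finset.sum_add_distrib, Finset.smul_sum, smul_smul]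
  rw [Finset.sum_comm, ← binom_fin' n k]
  simp only [← Finset.sum_smul]
  have h : ∀ j : Fin k, (∑ i : Fin k, n ^ (i:ℕ) * (j:ℕ).choose i) = (n+1)^(j:ℕ) :=
    fun j => binom_fin n k j j.2
  simp only [h, add_smul]
  abel

theorem polyVal_iterate (k : ℕ) (α : UnitAddCircle) (n : ℕ) : ∀ (a : Fin k → UnitAddCircle) (m : ℕ),
    polyVal k α ((shiftMap k α)^[n] a) m = polyVal k α a (m+n) := by
  induction n with
  | zero => intro a m; rfl
  | succ n ih =>
    intro a m
    rw [Function.iterate_succ_apply, ih, polyVal_shift, add_assoc]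

theorem shiftHom_continuous (k : ℕ) : Continuous (shiftHom k) := by
  refine continuous_pi fun i => ?_
  show Continuous fun a : Fin k → UnitAddCircle => ∑ j : Fin k, (j:ℕ).choose i • a j
  fun_prop

theorem shiftMap_continuous (k : ℕ) (α : UnitAddCircle) : Continuous (shiftMap k α) :=
  (shiftHom_continuous k).add continuous_const

theorem shiftMap_mp (k : ℕ) (α : UnitAddCircle) :
    MeasurePreserving (shiftMap k α) volume volume :=
  (measurePreserving_add_right volume _).comp
    ((shiftHom k).measurePreserving (shiftHom_continuous k) (shiftHom_surjective k) rfl)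

/-- For any real `α`, any degree `k ≥ 1`, and any closed subset `I` of the circle `ℝ/ℤ`,
there is a choice of lower-order coefficients `a 0, …, a (k-1)` so that the sequence
`p(n) mod 1`, with `p(x) = α x^k + a_{k-1} x^{k-1} + ⋯ + a_0`, is heavy for `I`. -/
theorem polynomial_sequence_heavy
    (α : ℝ) (k : ℕ) (hk : 1 ≤ k) (I : Set UnitAddCircle) (hI : IsClosed I) :
    ∃ a : Fin k → ℝ, ∀ N : ℕ, 1 ≤ N →
      (N : ℝ) * (volume I).toReal ≤
        ((Finset.range N).filter (fun n =>
          ((↑(α * (n : ℝ) ^ k + ∑ j : Fin k, a j * (n : ℝ) ^ (j : ℕ)) : UnitAddCircle) ∈ I))).card := by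
  let z : Fin k := ⟨0, hk⟩
  let J : Set (Fin k → UnitAddCircle) := Function.eval z ⁻¹' I
  have hJ : IsClosed J := hI.preimage (continuous_apply z)
  have hP0 : ∀ a, polyVal k (α : UnitAddCircle) a 0 = a z := by
    intro a
    rw [polyVal, zero_pow (by omega), zero_smul, zero_add, Finset.sum_eq_single z]
    · simp [z]
    · intro j _ hj
      have : (j:ℕ) ≠ 0 := fun h => hj (Fin.ext h)
      simp [this]
    · simp
  have hp1 : IsProbabilityMeasure (volume : Measure UnitAddCircle) := ⟨by simp⟩
  have : IsProbabilityMeasure (volume : Measure (Fin k → UnitAddCircle)) :=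
    inferInstanceAs (IsProbabilityMeasure (Measure.pi fun _ : Fin k => (volume : Measure UnitAddCircle)))
  obtain ⟨x, hx⟩ := heavy_exists (volume : Measure (Fin k → UnitAddCircle))
    (shiftMap k α) (shiftMap_continuous k α) (shiftMap_mp k α) J hJ
  choose a ha using fun j => QuotientAddGroup.mk_surjective (x j)
  refine ⟨a, fun N _ => ?_⟩
  have hvol : (volume : Measure (Fin k → UnitAddCircle)).real J = (volume I).toReal := by
    exact congrArg ENNReal.toReal ((measurePreserving_eval (fun _ : Fin k => (volume : Measure UnitAddCircle)) z).measure_preimage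
      hI.measurableSet.nullMeasurableSet)
  have h := hx N
  rw [hvol] at h
  refine h.trans (le_of_eq ?_)
  rw [Finset.card_filter, birkhoffSum]
  push_cast
  have himg : (do let a ← Finset.range N; pure ((a:ℕ):ℝ) : Finset ℝ)
      = (Finset.range N).image (fun n : ℕ => (n:ℝ)) := by
    ext y; simp
  rw [himg, Finset.sum_image (fun m _ n _ h => Nat.cast_injective h)]
  refine Finset.sum_congr rfl fun n _ => ?_
  have hval : ((α * (n : ℝ) ^ k + ∑ j : Fin k, a j * (n : ℝ) ^ (j : ℕ) : ℝ) : UnitAddCircle)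
      = ((shiftMap k α)^[n] x) z := by
    rw [← hP0 ((shiftMap k α)^[n] x), polyVal_iterate, zero_add, polyVal]
    have hx' : ∀ j, x j = ((a j : ℝ) : UnitAddCircle) := fun j => (ha j).symm
    have hc : ∀ (m : ℕ) (y : ℝ), m • (y : UnitAddCircle) = ((y * (m:ℝ) : ℝ) : UnitAddCircle) := by
      intro m y
      rw [← AddCircle.coe_nsmul, nsmul_eq_mul, mul_comm]
    have hs : ∀ g : Fin k → ℝ, ((∑ j, g j : ℝ) : UnitAddCircle) = ∑ j, (g j : UnitAddCircle) :=
      fun g => map_sum (QuotientAddGroup.mk' (AddSubgroup.zmultiples (1:ℝ))) g Finset.univ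
    rw [AddCircle.coe_add, hs]
    simp only [hx', hc]
    push_cast
    rfl
  rw [hval, Set.indicator_apply]
  rfl
end

section
/- Let X be a nonempty compact topological space, T : X → X a homeomorphism, and μ a T-invariant Borel probability measure on X. Then for every continuous f : X → ℝ there exists a point x ∈ X such that for every natural number N ≥ 1, ∑_{i=1}^{N} f(T^{−i} x) ≤ N · ∫_X f dμ. -/
open MeasureTheory

/-- Truncated maximal function of the Birkhoff sums, defined recursively. -/
def peresPhi {X : Type*} (R : X → X) (g : X → ℝ) : ℕ → X → ℝ
  | 0 => fun _ => 0
  | k + 1 => fun x => max 0 (g x + peresPhi R g k (R x))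

theorem peresPhi_cont {X : Type*} [TopologicalSpace X] (R : X → X) (g : X → ℝ)
    (hR : Continuous R) (hg : Continuous g) (k : ℕ) : Continuous (peresPhi R g k) := by
  induction k with
  | zero => exact continuous_const
  | succ k ih => exact continuous_const.max (hg.add (ih.comp hR))

theorem peresPhi_nonneg {X : Type*} (R : X → X) (g : X → ℝ) (k : ℕ) (x : X) :
    0 ≤ peresPhi R g k x := by
  cases k with
  | zero => exact le_refl _
  | succ k => exact le_max_left _ _

theorem peresPhi_mono {X : Type*} (R : X → X) (g : X → ℝ) (k : ℕ) (x : X) :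
    peresPhi R g k x ≤ peresPhi R g (k + 1) x := by
  induction k generalizing x with
  | zero => exact peresPhi_nonneg R g 1 x
  | succ k ih =>
    exact max_le_max (le_refl _) (add_le_add (le_refl _) (ih (R x)))

theorem peresPhi_ge {X : Type*} (R : X → X) (g : X → ℝ) (k n : ℕ) (hn : n ≤ k) (x : X) :
    birkhoffSum R g n x ≤ peresPhi R g k x := by
  induction k generalizing x n with
  | zero =>
    obtain rfl : n = 0 := by omega
    simp [peresPhi]
  | succ k ih =>
    cases n with
    | zero => simpa using peresPhi_nonneg R g (k + 1) x
    | succ n =>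
      rw [birkhoffSum_succ']
      exact (add_le_add (le_refl _) (ih n (by omega) (R x))).trans (le_max_right _ _)

theorem peres_finite_s8 {X : Type*} [TopologicalSpace X] [CompactSpace X]
    [MeasurableSpace X] [BorelSpace X] (R : X → X) (hR : Continuous R)
    (μ : Measure X) [IsProbabilityMeasure μ] (hμ : MeasurePreserving R μ μ)
    (g : X → ℝ) (hg : Continuous g) (hneg : ∫ x, g x ∂μ < 0) (M : ℕ) :
    ∃ x, ∀ n ≤ M, birkhoffSum R g n x ≤ 0 := by
  by_contra! h
  have int : ∀ u : X → ℝ, Continuous u → Integrable u μ := fun u hu =>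
    hu.integrable_of_hasCompactSupport (HasCompactSupport.of_compactSpace u)
  have hc := peresPhi_cont R g hR hg M
  have key : ∀ x, peresPhi R g M x ≤ g x + peresPhi R g M (R x) := by
    intro x
    obtain ⟨n, hn, hpos⟩ := h x
    have h1 := hpos.trans_le (peresPhi_ge R g M n hn x)
    cases M with
    | zero => simp [peresPhi] at h1
    | succ k =>
      have h2 := peresPhi_mono R g k (R x)
      have h3 : peresPhi R g (k + 1) x = max 0 (g x + peresPhi R g k (R x)) := rfl
      rw [h3] at h1 ⊢
      rcases lt_max_iff.1 h1 with h4 | h4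
      · exact absurd h4 (lt_irrefl _)
      · rw [max_eq_right h4.le]
        linarith
  have h5 := integral_mono (int _ hc) ((int _ hg).add (int _ (hc.comp hR))) key
  have h6 : ∫ x, peresPhi R g M (R x) ∂μ = ∫ x, peresPhi R g M x ∂μ := by
    conv_rhs => rw [← hμ.map_eq]
    rw [integral_map hμ.aemeasurable hc.measurable.aestronglyMeasurable]
  have h7 : ∫ x, (g + peresPhi R g M ∘ R) x ∂μ
      = ∫ x, g x ∂μ + ∫ x, peresPhi R g M (R x) ∂μ :=
    integral_add (int _ hg) (int _ (hc.comp hR))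
  have h8 : ∫ x, peresPhi R g M x ∂μ ≤ ∫ x, (g + peresPhi R g M ∘ R) x ∂μ := h5
  linarith

/-- Peres' lemma for negative times: for a homeomorphism `T` of a nonempty compact space
preserving a Borel probability measure `μ` and continuous `f`, there is a point whose
negative-time Birkhoff sums are dominated by the expected value. -/
theorem peres_lemma_negative_times
    {X : Type*} [TopologicalSpace X] [CompactSpace X] [Nonempty X]
    [MeasurableSpace X] [BorelSpace X]
    (T : X ≃ₜ X)
    (μ : Measure X) [IsProbabilityMeasure μ] (hμ : MeasurePreserving T μ μ)
    (f : X → ℝ) (hf : Continuous f) :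
    ∃ x : X, ∀ N : ℕ, 1 ≤ N →
      ∑ i ∈ Finset.Icc 1 N, f ((⇑T.symm)^[i] x) ≤ (N : ℝ) * ∫ y, f y ∂μ := by
  have hR : Continuous T.symm := T.symm.continuous
  have hμ' : MeasurePreserving T.symm μ μ :=
    MeasurePreserving.symm T.toMeasurableEquiv hμ
  set c := ∫ y, f y ∂μ with hcdef
  have hfR : ∫ y, f (T.symm y) ∂μ = c := by
    rw [hcdef]
    conv_rhs => rw [← hμ'.map_eq]
    rw [integral_map hμ'.aemeasurable hf.measurable.aestronglyMeasurable]
  let K : ℕ → Set X := fun M => {x | ∀ N ≤ M,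
    ∑ i ∈ Finset.Icc 1 N, f ((⇑T.symm)^[i] x) ≤ (N : ℝ) * (c + 1 / ((M : ℝ) + 1))}
  have hclosed : ∀ M, IsClosed (K M) := by
    intro M
    simp only [K, Set.setOf_forall]
    refine isClosed_iInter fun N => isClosed_iInter fun _ => ?_
    refine isClosed_le ?_ continuous_const
    exact continuous_finset_sum _ fun i _ => hf.comp (hR.iterate i)
  have hne : ∀ M, (K M).Nonempty := by
    intro M
    have hε : (0 : ℝ) < 1 / ((M : ℝ) + 1) := by positivity
    have hi : Integrable (fun y => f (T.symm y)) μ :=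
      (hf.comp hR).integrable_of_hasCompactSupport (HasCompactSupport.of_compactSpace _)
    obtain ⟨x, hx⟩ := peres_finite_s8 T.symm hR μ hμ'
      (fun y => f (T.symm y) - (c + 1 / ((M : ℝ) + 1)))
      ((hf.comp hR).sub continuous_const)
      (by rw [integral_sub hi (integrable_const _), hfR]; simp; positivity) M
    refine ⟨x, fun N hN => ?_⟩
    have h := hx N hN
    simp only [birkhoffSum, Finset.sum_sub_distrib, Finset.sum_const, Finset.card_range,
      nsmul_eq_mul, ← Function.iterate_succ_apply'] at h
    have e : ∑ i ∈ Finset.Icc 1 N, f ((⇑T.symm)^[i] x)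
        = ∑ i ∈ Finset.range N, f ((⇑T.symm)^[i.succ] x) := by
      rw [Finset.range_eq_Ico, Finset.sum_Ico_add' (fun i => f ((⇑T.symm)^[i] x)) 0 N 1]
      rfl
    rw [e]
    linarith
  have hmono : ∀ M, K (M + 1) ⊆ K M := by
    intro M x hx N hN
    refine (hx N (by omega)).trans ?_
    push_cast
    gcongr
    linarith
  obtain ⟨x, hx⟩ := IsCompact.nonempty_iInter_of_sequence_nonempty_isCompact_isClosed K
    hmono hne (hclosed 0).isCompact hclosed
  refine ⟨x, fun N _ => ?_⟩
  have hlim : Filter.Tendsto (fun M : ℕ => (N : ℝ) * (c + 1 / ((M : ℝ) + 1))) Filter.atTop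
      (nhds ((N : ℝ) * (c + 0))) :=
    (tendsto_const_nhds.add tendsto_one_div_add_atTop_nhds_zero_nat).const_mul _
  rw [add_zero] at hlim
  refine ge_of_tendsto hlim ?_
  filter_upwards [Filter.eventually_ge_atTop N] with M hM
  exact Set.mem_iInter.1 hx M N hM
end

section
/- Let X be a nonempty compact metric space, T : X → X a homeomorphism, and μ a T-invariant Borel probability measure on X. Assume T is topologically transitive in the sense that there exists a point x₀ whose forward orbit {T^n x₀ : n ≥ 0} is dense in X. Then for every continuous f : X → ℝ there exists a point x ∈ X such that for every N ≥ 1, ∑_{i=0}^{N−1} f(T^i x) ≥ N ∫_X f dμ, and ∑_{i=1}^{N} f(T^{−i} x) ≤ N ∫_X f dμ. -/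
open MeasureTheory

section Helpers

variable {X : Type*} [MetricSpace X] [CompactSpace X] [Nonempty X]

lemma hv_cont (T : X ≃ₜ X) (g : X → ℝ) (hg : Continuous g) (n : ℕ) :
    Continuous (birkhoffSum T g n) := by
  unfold birkhoffSum
  exact continuous_finsetSum _ fun i _ => hg.comp (T.continuous.iterate i)

lemma hv_compact (T : X ≃ₜ X) (g : X → ℝ) (hg : Continuous g)
    (H : ∀ K : ℕ, ∀ ε : ℝ, 0 < ε → ∃ x, ∀ n ≤ K, -ε ≤ birkhoffSum T g n x ∧
      birkhoffSum T g n (T.symm^[n] x) ≤ ε) :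
    ∃ x, ∀ n, 0 ≤ birkhoffSum T g n x ∧ birkhoffSum T g n (T.symm^[n] x) ≤ 0 := by
  let F : ℕ → Set X := fun K => {x | ∀ n ≤ K, -(1 / ((K : ℝ) + 1)) ≤ birkhoffSum T g n x ∧
      birkhoffSum T g n (T.symm^[n] x) ≤ 1 / ((K : ℝ) + 1)}
  have hcl : ∀ K, IsClosed (F K) := by
    intro K
    have : F K = ⋂ n, ⋂ (_ : n ≤ K), {x | -(1 / ((K : ℝ) + 1)) ≤ birkhoffSum T g n x ∧
      birkhoffSum T g n (T.symm^[n] x) ≤ 1 / ((K : ℝ) + 1)} := by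
      ext x; simp [F]
    rw [this]
    refine isClosed_iInter fun n => isClosed_iInter fun _ => ?_
    exact (isClosed_le continuous_const (hv_cont T g hg n)).inter
      (isClosed_le ((hv_cont T g hg n).comp (T.symm.continuous.iterate n)) continuous_const)
  have hne : (⋂ K, F K).Nonempty := by
    refine IsCompact.nonempty_iInter_of_sequence_nonempty_isCompact_isClosed F ?_ ?_
      (hcl 0).isCompact hcl
    · intro K x hx n hn
      have h1 := hx n (by omega)
      have h2 : 1 / (((K + 1 : ℕ) : ℝ) + 1) ≤ 1 / ((K : ℝ) + 1) := by
        apply one_div_le_one_div_of_le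
        · positivity
        · push_cast; linarith
      constructor <;> linarith [h1.1, h1.2]
    · intro K
      exact H K _ (by positivity)
  obtain ⟨x, hx⟩ := hne
  rw [Set.mem_iInter] at hx
  refine ⟨x, fun n => ⟨?_, ?_⟩⟩
  · refine le_of_forall_pos_le_add fun ε hε => ?_
    obtain ⟨k, hk⟩ := exists_nat_one_div_lt hε
    have h1 := (hx (max n k) n (le_max_left _ _)).1
    have h2 : 1 / (((max n k : ℕ) : ℝ) + 1) ≤ 1 / ((k : ℝ) + 1) := by
      apply one_div_le_one_div_of_le
      · positivity
      · have : (k : ℝ) ≤ ((max n k : ℕ) : ℝ) := by exact_mod_cast le_max_right n k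
        linarith
    linarith
  · refine le_of_forall_pos_le_add fun ε hε => ?_
    obtain ⟨k, hk⟩ := exists_nat_one_div_lt hε
    have h1 := (hx (max n k) n (le_max_left _ _)).2
    have h2 : 1 / (((max n k : ℕ) : ℝ) + 1) ≤ 1 / ((k : ℝ) + 1) := by
      apply one_div_le_one_div_of_le
      · positivity
      · have : (k : ℝ) ≤ ((max n k : ℕ) : ℝ) := by exact_mod_cast le_max_right n k
        linarith
    linarith

lemma hv_add (T : X → X) (g : X → ℝ) (m n : ℕ) (x : X) :
    birkhoffSum T g (m + n) x = birkhoffSum T g m x + birkhoffSum T g n (T^[m] x) :=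
  birkhoffSum_add T g m n x

lemma hv_bound (T : X → X) (g : X → ℝ) (B : ℝ) (hB : ∀ x, |g x| ≤ B) (n : ℕ) (x : X) :
    |birkhoffSum T g n x| ≤ n * B := by
  unfold birkhoffSum
  refine (Finset.abs_sum_le_sum_abs _ _).trans ?_
  refine (Finset.sum_le_sum fun i _ => hB _).trans ?_
  simp

lemma hv_unbounded (T : X ≃ₜ X) (x₀ : X) (hx₀ : Dense (Set.range fun n : ℕ => (⇑T)^[n] x₀))
    (g : X → ℝ) (hg : Continuous g)
    (h1 : ∀ C : ℝ, ∃ n x, birkhoffSum T g n x < -C)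
    (h2 : ∀ C : ℝ, ∃ n x, C < birkhoffSum T g n x) (K : ℕ) :
    ∃ x, ∀ n ≤ K, 0 ≤ birkhoffSum T g n x ∧ birkhoffSum T g n (T.symm^[n] x) ≤ 0 := by
  obtain ⟨B, hB⟩ : ∃ B : ℝ, ∀ x, |g x| ≤ B := by
    obtain ⟨B, hB⟩ := isCompact_univ.exists_bound_of_continuousOn (f := g) hg.continuousOn
    exact ⟨B, fun x => by simpa using hB x (Set.mem_univ x)⟩
  have hB0 : 0 ≤ B := (abs_nonneg _).trans (hB x₀)
  have hsmall : ∀ n ≤ K, ∀ x, |birkhoffSum T g n x| ≤ K * B := by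
    intro n hn x
    refine (hv_bound T g B hB n x).trans ?_
    gcongr
  obtain ⟨n, a, ha⟩ := h1 (K * B)
  obtain ⟨m, b, hb⟩ := h2 (K * B)
  obtain ⟨_, hs, ⟨s, rfl⟩⟩ := hx₀.inter_open_nonempty {x | birkhoffSum T g n x < -(K * B)}
    (isOpen_lt (hv_cont T g hg n) continuous_const) ⟨a, ha⟩
  simp only [Set.mem_ofPred_eq] at hs
  set y := T^[s] x₀ with hy
  have hopen : IsOpen {x | K * B < birkhoffSum T g m (T^[n + s] x)} :=
    isOpen_lt continuous_const ((hv_cont T g hg m).comp (T.continuous.iterate _))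
  obtain ⟨_, ht, ⟨t, rfl⟩⟩ := hx₀.inter_open_nonempty _ hopen (by
    obtain ⟨c, hc⟩ := (T.surjective.iterate (n + s)) b
    exact ⟨c, by simp only [Set.mem_ofPred_eq, hc]; exact hb⟩)
  simp only [Set.mem_ofPred_eq, ← Function.iterate_add_apply] at ht
  have ht' : K * B < birkhoffSum T g m (T^[n + t] y) := by
    rw [hy, ← Function.iterate_add_apply]
    convert ht using 3
    omega
  obtain ⟨j, hj, hmin⟩ := Finset.exists_min_image (Finset.range (n + t + m + 1))
    (fun j => birkhoffSum T g j y) ⟨0, by simp⟩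
  simp only [Finset.mem_range] at hj hmin
  have hjn := hmin n (by omega)
  have hjt := hmin (n + t) (by omega)
  have htm := hv_add T g (n + t) m y
  have hjK : K < j := by
    by_contra hcon
    have := (abs_le.1 (hsmall j (by omega) y)).1
    linarith
  have hjK2 : j + K < n + t + m := by
    by_contra hcon
    have h3 := hv_add T g j (n + t + m - j) y
    rw [show j + (n + t + m - j) = n + t + m by omega] at h3
    have := (abs_le.1 (hsmall (n + t + m - j) (by omega) (T^[j] y))).2
    linarith
  refine ⟨T^[j] y, fun k hk => ⟨?_, ?_⟩⟩
  · have h3 := hv_add T g j k y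
    have h4 := hmin (j + k) (by omega)
    linarith
  · have h3 := hv_add T g (j - k) k y
    have h4 := hmin (j - k) (by omega)
    rw [show j - k + k = j by omega] at h3
    have h5 : T.symm^[k] (T^[j] y) = T^[j - k] y := by
      have : T^[j] y = T^[k] (T^[j - k] y) := by
        rw [← Function.iterate_add_apply T k (j - k) y, show k + (j - k) = j by omega]
      rw [this]
      exact (T.left_inv : Function.LeftInverse T.symm T).iterate k _
    rw [h5]
    linarith

lemma hv_bddBelow [MeasurableSpace X] [BorelSpace X] (T : X ≃ₜ X)
    (μ : Measure X) [IsProbabilityMeasure μ] (hμ : MeasurePreserving T μ μ)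
    (hμ' : MeasurePreserving T.symm μ μ)
    (g : X → ℝ) (hg : Continuous g) (hg0 : ∫ x, g x ∂μ = 0)
    (C : ℝ) (hC : ∀ n x, -C ≤ birkhoffSum T g n x) (ε : ℝ) (hε : 0 < ε) :
    ∃ x, ∀ n, -ε ≤ birkhoffSum T g n x ∧ birkhoffSum T g n (T.symm^[n] x) ≤ ε := by
  let h : X → ℝ := fun x => ⨅ n, birkhoffSum T g n x
  have hbdd : ∀ x, BddBelow (Set.range fun n => birkhoffSum T g n x) := fun x =>
    ⟨-C, by rintro _ ⟨n, rfl⟩; exact hC n x⟩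
  have hm : Measurable h := Measurable.iInf fun n => (hv_cont T g hg n).measurable
  have hle : ∀ x, h x ≤ 0 := fun x => by
    have := ciInf_le (hbdd x) 0
    simpa using this
  have hge : ∀ x, -C ≤ h x := fun x => le_ciInf fun n => hC n x
  have hint : Integrable h μ := by
    refine Integrable.of_bound hm.aestronglyMeasurable C (Filter.Eventually.of_forall fun x => ?_)
    rw [Real.norm_eq_abs, abs_le]
    have := hle x; have := hge x
    constructor <;> linarith
  have hintT : Integrable (fun x => h (T x)) μ := hμ.integrable_comp_of_integrable hint
  have hgi : Integrable g μ := by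
    rw [← integrableOn_univ]
    exact hg.continuousOn.integrableOn_compact isCompact_univ
  have hφ : ∀ x, 0 ≤ g x + h (T x) - h x := by
    intro x
    have : h x - g x ≤ h (T x) := by
      refine le_ciInf fun n => ?_
      have h1 := ciInf_le (hbdd x) (n + 1)
      rw [birkhoffSum_succ'] at h1
      simp only [h]
      linarith
    linarith
  have hφ0 : ∫ x, (g x + h (T x) - h x) ∂μ = 0 := by
    have e1 : ∫ x, (g x + h (T x) - h x) ∂μ = ∫ x, (g x + h (T x)) ∂μ - ∫ x, h x ∂μ :=
      integral_sub (hgi.add hintT) hint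
    rw [e1, integral_add hgi hintT, hg0,
      hμ.integral_comp T.measurableEmbedding]
    simp
  have hφae : ∀ᵐ x ∂μ, g x + h (T x) - h x = 0 :=
    (integral_eq_zero_iff_of_nonneg hφ ((hgi.add hintT).sub hint)).1 hφ0
  have hall : ∀ᵐ x ∂μ, ∀ n, birkhoffSum T g n x = h x - h (T^[n] x) := by
    have : ∀ᵐ x ∂μ, ∀ n : ℕ, g (T^[n] x) + h (T (T^[n] x)) - h (T^[n] x) = 0 :=
      ae_all_iff.2 fun n => (hμ.iterate n).quasiMeasurePreserving.ae hφae
    filter_upwards [this] with x hx n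
    induction n with
    | zero => simp
    | succ n ih =>
      rw [birkhoffSum_succ, ih, Function.iterate_succ_apply']
      linarith [hx n]
  have hbu : Filter.IsBoundedUnder (· ≤ ·) (ae μ) h :=
    Filter.isBoundedUnder_of ⟨0, hle⟩
  have hbu' : Filter.IsBoundedUnder (· ≥ ·) (ae μ) h :=
    Filter.isBoundedUnder_of ⟨-C, hge⟩
  have hM : ∀ᵐ x ∂μ, h x ≤ essSup h μ := ae_le_essSup hbu
  have hfreq : ∃ᶠ x in ae μ, essSup h μ - ε < h x := by
    intro hcon
    have h1 : essSup h μ ≤ essSup h μ - ε := by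
      refine Filter.limsup_le_of_le hbu'.isCoboundedUnder_le ?_
      filter_upwards [hcon] with x hx
      exact not_lt.1 hx
    linarith
  have hM1 : ∀ᵐ x ∂μ, ∀ n, h (T^[n] x) ≤ essSup h μ :=
    ae_all_iff.2 fun n => (hμ.iterate n).quasiMeasurePreserving.ae hM
  have hM2 : ∀ᵐ x ∂μ, ∀ n, h (T.symm^[n] x) ≤ essSup h μ :=
    ae_all_iff.2 fun n => (hμ'.iterate n).quasiMeasurePreserving.ae hM
  have hall2 : ∀ᵐ x ∂μ, ∀ k n, birkhoffSum T g n (T.symm^[k] x)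
      = h (T.symm^[k] x) - h (T^[n] (T.symm^[k] x)) :=
    ae_all_iff.2 fun n => (hμ'.iterate n).quasiMeasurePreserving.ae hall
  obtain ⟨x, hx, h1, h2, h3, h4⟩ :=
    (hfreq.and_eventually (hM1.and (hM2.and (hall.and hall2)))).exists
  refine ⟨x, fun n => ⟨?_, ?_⟩⟩
  · rw [h3 n]; linarith [h1 n]
  · rw [h4 n n, Function.LeftInverse.iterate (f := T.symm) (g := T) T.apply_symm_apply n x]
    linarith [h2 n]

lemma hv_symm (T : X ≃ₜ X) (g : X → ℝ) (n : ℕ) (x : X) :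
    birkhoffSum T.symm (fun y => -g (T.symm y)) n x = -birkhoffSum T g n (T.symm^[n] x) := by
  induction n with
  | zero => simp
  | succ n ih =>
    rw [birkhoffSum_succ, ih, birkhoffSum_succ', Function.iterate_succ_apply']
    simp [add_comm]

lemma hv_icc (T : X ≃ₜ X) (g : X → ℝ) (n : ℕ) (x : X) :
    ∑ i ∈ Finset.Icc 1 n, g (T.symm^[i] x) = birkhoffSum T g n (T.symm^[n] x) := by
  induction n with
  | zero => simp
  | succ n ih =>
    rw [Finset.sum_Icc_succ_top (by omega), ih, birkhoffSum_succ', Function.iterate_succ_apply']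
    simp
    ring

lemma hv_main [MeasurableSpace X] [BorelSpace X] (T : X ≃ₜ X)
    (μ : Measure X) [IsProbabilityMeasure μ] (hμ : MeasurePreserving T μ μ)
    (x₀ : X) (hx₀ : Dense (Set.range fun n : ℕ => (⇑T)^[n] x₀))
    (g : X → ℝ) (hg : Continuous g) (hg0 : ∫ x, g x ∂μ = 0) :
    ∃ x, ∀ n, 0 ≤ birkhoffSum T g n x ∧ birkhoffSum T g n (T.symm^[n] x) ≤ 0 := by
  have hμ' : MeasurePreserving T.symm μ μ :=
    MeasurePreserving.symm T.toMeasurableEquiv hμ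
  apply hv_compact T g hg
  intro K ε hε
  by_cases h1 : ∀ C : ℝ, ∃ n x, birkhoffSum T g n x < -C
  · by_cases h2 : ∀ C : ℝ, ∃ n x, C < birkhoffSum T g n x
    · obtain ⟨x, hx⟩ := hv_unbounded T x₀ hx₀ g hg h1 h2 K
      exact ⟨x, fun n hn => ⟨by linarith [(hx n hn).1], by linarith [(hx n hn).2]⟩⟩
    · push Not at h2
      obtain ⟨C, hC⟩ := h2
      obtain ⟨x, hx⟩ := hv_bddBelow T.symm μ hμ' hμ (fun y => -g (T.symm y))
        (hg.comp T.symm.continuous).neg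
        (by rw [integral_neg, hμ'.integral_comp T.symm.measurableEmbedding, hg0, neg_zero]) C
        (fun n x => by rw [hv_symm]; linarith [hC n (T.symm^[n] x)]) ε hε
      refine ⟨x, fun n _ => ?_⟩
      have h3 := hx n
      rw [hv_symm, hv_symm, Homeomorph.symm_symm,
        Function.LeftInverse.iterate (f := T) (g := T.symm) T.symm_apply_apply n x] at h3
      constructor <;> linarith [h3.1, h3.2]
  · push Not at h1
    obtain ⟨C, hC⟩ := h1
    obtain ⟨x, hx⟩ := hv_bddBelow T μ hμ hμ' g hg hg0 C hC ε hε
    exact ⟨x, fun n _ => hx n⟩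

end Helpers

/-- For a transitive homeomorphism of a nonempty compact metric space preserving a Borel
probability measure, every continuous function admits a point heavy for all integer
times. -/
theorem two_sided_heavy_point_of_transitive
    {X : Type*} [MetricSpace X] [CompactSpace X] [Nonempty X]
    [MeasurableSpace X] [BorelSpace X]
    (T : X ≃ₜ X)
    (μ : Measure X) [IsProbabilityMeasure μ] (hμ : MeasurePreserving T μ μ)
    (x₀ : X) (hx₀ : Dense (Set.range fun n : ℕ => (⇑T)^[n] x₀))
    (f : X → ℝ) (hf : Continuous f) :
    ∃ x : X, ∀ N : ℕ, 1 ≤ N →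
      (N : ℝ) * ∫ y, f y ∂μ ≤ ∑ i ∈ Finset.range N, f ((⇑T)^[i] x) ∧
      ∑ i ∈ Finset.Icc 1 N, f ((⇑T.symm)^[i] x) ≤ (N : ℝ) * ∫ y, f y ∂μ := by
  have hfi : Integrable f μ := by
    rw [← integrableOn_univ]
    exact hf.continuousOn.integrableOn_compact isCompact_univ
  obtain ⟨x, hx⟩ := hv_main T μ hμ x₀ hx₀ (fun y => f y - ∫ z, f z ∂μ)
    (hf.sub continuous_const) (by
      rw [integral_sub hfi (integrable_const _)]; simp)
  refine ⟨x, fun N _ => ?_⟩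
  obtain ⟨h1, h2⟩ := hx N
  rw [← hv_icc] at h2
  simp only [birkhoffSum, Finset.sum_sub_distrib, Finset.sum_const, Finset.card_range,
    Nat.card_Icc, Nat.add_sub_cancel, nsmul_eq_mul] at h1 h2
  constructor <;> linarith
end

section
/- Let X be a compact topological space, T : X → X a homeomorphism, and f : X → ℝ continuous. Suppose there exists a point y ∈ X such that S_n(y) ≥ 0 for all n ≥ 1 and S_n(y) = 0 for infinitely many n ≥ 1, where S_n(y) = ∑_{i=0}^{n−1} f(T^i y). Then there exists a point x ∈ X such that S_n(x) ≥ 0 for all integers n (where S_{−n}(x) = −∑_{i=1}^{n} f(T^{−i} x) for n ≥ 1 and S_0(x) = 0). -/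
/-- If a homeomorphism of a compact space has a point `y` whose forward Birkhoff sums
of a continuous `f` are nonnegative and vanish infinitely often, then there exists a
point whose two-sided Birkhoff sums are all nonnegative. -/
theorem two_sided_heavy_point_of_recurrent_zero_sums
    {X : Type*} [TopologicalSpace X] [CompactSpace X]
    (T : X ≃ₜ X) (f : X → ℝ) (hf : Continuous f)
    (y : X)
    (hy : ∀ n : ℕ, 1 ≤ n → 0 ≤ ∑ i ∈ Finset.range n, f ((⇑T)^[i] y))
    (hy0 : {n : ℕ | 1 ≤ n ∧ ∑ i ∈ Finset.range n, f ((⇑T)^[i] y) = 0}.Infinite) :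
    ∃ x : X,
      (∀ n : ℕ, 1 ≤ n → 0 ≤ ∑ i ∈ Finset.range n, f ((⇑T)^[i] x)) ∧
      (∀ n : ℕ, 1 ≤ n → ∑ i ∈ Finset.Icc 1 n, f ((⇑T.symm)^[i] x) ≤ 0) := by
  classical
  set S : ℕ → ℝ := fun n => ∑ i ∈ Finset.range n, f ((⇑T)^[i] y) with hS
  have hS0 : ∀ n, 0 ≤ S n := by
    intro n
    rcases Nat.eq_zero_or_pos n with h | h
    · simp [hS, h]
    · exact hy n h
  set A : Set ℕ := {n : ℕ | 1 ≤ n ∧ S n = 0} with hA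
  have hfreq : ∃ᶠ n in Filter.atTop, n ∈ A := Nat.frequently_atTop_iff_infinite.mpr hy0
  let F : Filter ℕ := Filter.atTop ⊓ Filter.principal A
  haveI : F.NeBot := Filter.frequently_mem_iff_neBot.mp hfreq
  let u : ℕ → X := fun n => (⇑T)^[n] y
  obtain ⟨x, hx⟩ := exists_clusterPt_of_compactSpace (Filter.map u F)
  have key : ∀ C : Set X, IsClosed C → (∀ᶠ n in F, u n ∈ C) → x ∈ C := by
    intro C hC h
    exact hC.closure_subset (mem_closure_iff_clusterPt.mpr
      (hx.mono (Filter.le_principal_iff.mpr h)))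
  have hFA : ∀ᶠ n in F, n ∈ A := Filter.mem_inf_of_right (Filter.mem_principal_self A)
  have hFge : ∀ k : ℕ, ∀ᶠ n in F, k ≤ n := fun k =>
    Filter.mem_inf_of_left (Filter.eventually_ge_atTop k)
  refine ⟨x, fun n _ => ?_, fun n _ => ?_⟩
  · refine key {z | 0 ≤ ∑ i ∈ Finset.range n, f ((⇑T)^[i] z)} ?_ ?_
    · exact isClosed_le continuous_const
        (continuous_finsetSum _ fun i _ => hf.comp (T.continuous.iterate i))
    · filter_upwards [hFA] with m hm
      have h1 : S (m + n) = S m + ∑ i ∈ Finset.range n, f ((⇑T)^[i] (u m)) := by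
        simp only [hS, u, Finset.sum_range_add, ← Function.iterate_add_apply]
        congr 1
        exact Finset.sum_congr rfl fun i _ => by rw [add_comm]
      have h2 := hS0 (m + n)
      rw [h1, hm.2, zero_add] at h2
      exact h2
  · refine key {z | ∑ i ∈ Finset.Icc 1 n, f ((⇑T.symm)^[i] z) ≤ 0} ?_ ?_
    · exact isClosed_le
        (continuous_finsetSum _ fun i _ => hf.comp (T.symm.continuous.iterate i))
        continuous_const
    · filter_upwards [hFA, hFge n] with m hm hnm
      have h1 : ∀ k, k ≤ m →
          ∑ i ∈ Finset.Icc 1 k, f ((⇑T.symm)^[i] (u m)) + S (m - k) = S m := by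
        intro k
        induction k with
        | zero => intro _; simp
        | succ k ih =>
          intro hk
          have ih' := ih (by omega)
          have e : m - k = (m - (k + 1)) + 1 := by omega
          have e2 : (⇑T.symm)^[k + 1] (u m) = (⇑T)^[m - (k + 1)] y := by
            have e3 : u m = (⇑T)^[k + 1] ((⇑T)^[m - (k + 1)] y) := by
              rw [← Function.iterate_add_apply]
              simp only [u]
              congr 2
              omega
            rw [e3]
            exact (Function.LeftInverse.iterate T.symm_apply_apply (k + 1)) _
          have e4 : S (m - k) = S (m - (k + 1)) + f ((⇑T)^[m - (k + 1)] y) := by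
            rw [e]; simp only [hS, Finset.sum_range_succ]
          rw [Finset.sum_Icc_succ_top (by omega), e2]
          linarith
      have h2 := h1 n hnm
      have h3 := hS0 (m - n)
      rw [hm.2] at h2
      show _ ≤ _
      linarith
end

section
/- Let (X, μ) be a probability space and T : X → X an invertible measure-preserving transformation (with measurable measure-preserving inverse). Then T is ergodic if and only if for every integrable f : X → ℝ with ∫_X f dμ = 0 and all integers n₁ < n₂, the set H(n₁, n₂) = {x ∈ X : S_i(x) ≥ 0 for all integers i with n₁ ≤ i ≤ n₂} has positive μ-measure, where S_0(x) = 0, S_n(x) = ∑_{i=0}^{n−1} f(T^i x) for n ≥ 1, and S_{−n}(x) = −∑_{i=1}^{n} f(T^{−i} x) for n ≥ 1. -/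
open MeasureTheory

/-- Two-sided Birkhoff sums of `f` along an invertible map `T`:
`S 0 = 0`, `S n x = ∑_{i=0}^{n-1} f (T^i x)` for `n ≥ 1`, and
`S (-n) x = -∑_{i=1}^{n} f (T⁻ⁱ x)` for `n ≥ 1`. -/
noncomputable def birkhoffZ {X : Type*} (T : X ≃ X) (f : X → ℝ) : ℤ → X → ℝ
  | Int.ofNat n, x => ∑ i ∈ Finset.range n, f ((⇑T)^[i] x)
  | Int.negSucc n, x => -∑ i ∈ Finset.Icc 1 (n + 1), f ((⇑T.symm)^[i] x)

noncomputable def blockMin (u : ℕ → ℝ) (N : ℕ) (k : ℕ) : ℝ :=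
  (Finset.range (N + 1)).inf' Finset.nonempty_range_add_one (fun j => u (k + j))

lemma blockMin_le (u : ℕ → ℝ) (N k j : ℕ) (hj : j ≤ N) : blockMin u N k ≤ u (k + j) :=
  Finset.inf'_le (fun j => u (k + j)) (by simp; omega)

lemma blockMin_exists (u : ℕ → ℝ) (N k : ℕ) : ∃ j ≤ N, blockMin u N k = u (k + j) := by
  obtain ⟨j, hj, h⟩ := Finset.exists_mem_eq_inf' (s := Finset.range (N + 1)) Finset.nonempty_range_add_one
    (fun j => u (k + j))
  exact ⟨j, by simp at hj; omega, h⟩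

lemma blockMin_le' (u : ℕ → ℝ) (N k m : ℕ) (h1 : k ≤ m) (h2 : m ≤ k + N) :
    blockMin u N k ≤ u m := by
  have := blockMin_le u N k (m - k) (by omega)
  rwa [show k + (m - k) = m by omega] at this

lemma blockMin_birkhoff {X : Type*} (T : X → X) (f : X → ℝ) (N k : ℕ) (x : X) :
    blockMin (fun n => birkhoffSum T f n x) N k =
      birkhoffSum T f k x + blockMin (fun n => birkhoffSum T f n (T^[k] x)) N 0 := by
  apply le_antisymm
  · obtain ⟨j, hj, h⟩ := blockMin_exists (fun n => birkhoffSum T f n (T^[k] x)) N 0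
    rw [h]
    have := blockMin_le (fun n => birkhoffSum T f n x) N k j hj
    simp only [birkhoffSum_add, zero_add] at this ⊢
    exact this
  · obtain ⟨j, hj, h⟩ := blockMin_exists (fun n => birkhoffSum T f n x) N k
    rw [h]
    have := blockMin_le (fun n => birkhoffSum T f n (T^[k] x)) N 0 j hj
    simp only [birkhoffSum_add, zero_add] at this ⊢
    linarith

lemma block_step (u : ℕ → ℝ) (N k : ℕ)
    (hu : ∀ m, N + 1 ≤ m → ∃ j, m ≤ j + (N + 1) ∧ j ≤ m + (N + 1) ∧ u j < u m)
    (h : blockMin u N (k + (N + 1)) ≤ blockMin u N (k + (N + 1) + (N + 1))) :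
    blockMin u N k < blockMin u N (k + (N + 1)) := by
  by_contra hc
  push Not at hc
  obtain ⟨j, hj, hm⟩ := blockMin_exists u N (k + (N + 1))
  obtain ⟨i, h1, h2, h3⟩ := hu (k + (N + 1) + j) (by omega)
  rw [← hm] at h3
  by_cases c1 : i ≤ k + N
  · have := blockMin_le' u N k i (by omega) (by omega)
    linarith
  by_cases c2 : i ≤ k + (N + 1) + N
  · have := blockMin_le' u N (k + (N + 1)) i (by omega) (by omega)
    linarith
  · have := blockMin_le' u N (k + (N + 1) + (N + 1)) i (by omega) (by omega)
    linarith

/-- interleaving: strict increase of blocks at phase 0 forces the same at phase 1 -/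
lemma block_phase (u : ℕ → ℝ) (N : ℕ)
    (h1 : blockMin u N (N + 1) < blockMin u N (N + 1 + (N + 1)))
    (h2 : blockMin u N (N + 1 + (N + 1)) < blockMin u N (N + 1 + (N + 1) + (N + 1)))
    (g0 : blockMin u N (1 + (N + 1)) < blockMin u N 1)
    (g1 : blockMin u N (1 + (N + 1) + (N + 1)) < blockMin u N (1 + (N + 1))) : False := by
  have e1 : blockMin u N (1 + (N + 1)) ≤ blockMin u N (N + 1) := by
    obtain ⟨j, hj, hm⟩ := blockMin_exists u N (N + 1)
    rw [hm]
    rcases Nat.eq_zero_or_pos j with rfl | hp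
    · have := blockMin_le' u N 1 (N + 1 + 0) (by omega) (by omega)
      linarith
    · exact blockMin_le' u N _ _ (by omega) (by omega)
  have e2 : blockMin u N (N + 1 + (N + 1)) ≤ blockMin u N (1 + (N + 1) + (N + 1)) := by
    obtain ⟨j, hj, hm⟩ := blockMin_exists u N (1 + (N + 1) + (N + 1))
    rw [hm]
    by_cases c : j < N
    · exact blockMin_le' u N _ _ (by omega) (by omega)
    · have := blockMin_le' u N (N + 1 + (N + 1) + (N + 1)) (1 + (N + 1) + (N + 1) + j)
        (by omega) (by omega)
      linarith
  linarith

lemma birkhoffZ_iterate {X : Type*} (T : X ≃ X) (f : X → ℝ) (M j : ℕ) (i : ℤ) (x : X)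
    (h : (j : ℤ) = M + i) :
    birkhoffZ T f i (T^[M] x) = birkhoffSum T f j x - birkhoffSum T f M x := by
  cases i with
  | ofNat n =>
    obtain rfl : j = M + n := by simp at h; omega
    rw [birkhoffSum_add]
    simp [birkhoffZ, birkhoffSum]
  | negSucc n =>
    obtain rfl : M = j + (n + 1) := by omega
    rw [birkhoffSum_add]
    simp only [birkhoffZ, birkhoffSum, sub_add_cancel_left]
    congr 1
    refine Finset.sum_nbij' (fun i => n + 1 - i) (fun k => n + 1 - k) ?_ ?_ ?_ ?_ ?_
    · intro a ha; simp at ha ⊢; omega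
    · intro a ha; simp at ha ⊢; omega
    · intro a ha; simp at ha ⊢; omega
    · intro a ha; simp at ha ⊢; omega
    · intro a ha
      simp at ha
      rw [← Function.iterate_add_apply,
        show j + (n + 1) = a + (n + 1 - a + j) by omega, Function.iterate_add_apply]
      exact congrArg f (Function.LeftInverse.iterate T.left_inv a _)

lemma birkhoffSum_integrable {X : Type*} [MeasurableSpace X] {μ : Measure X} {T : X → X}
    (hT : MeasurePreserving T μ μ) {f : X → ℝ} (hf : Integrable f μ) (n : ℕ) :
    Integrable (fun x => birkhoffSum T f n x) μ := by
  unfold birkhoffSum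
  exact integrable_finsetSum _ fun i _ => (hT.iterate i).integrable_comp_of_integrable hf

lemma integral_comp_mp {X : Type*} [MeasurableSpace X] {μ : Measure X} {T : X → X}
    (hT : MeasurePreserving T μ μ) {f : X → ℝ} (hf : Integrable f μ) :
    ∫ x, f (T x) ∂μ = ∫ x, f x ∂μ := by
  have := integral_map (μ := μ) (φ := T) (f := f) hT.measurable.aemeasurable
    (by rw [hT.map_eq]; exact hf.aestronglyMeasurable)
  rw [hT.map_eq] at this
  exact this.symm

lemma blockMin_integrable {X : Type*} [MeasurableSpace X] {μ : Measure X} {T : X → X}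
    (hT : MeasurePreserving T μ μ) {f : X → ℝ} (hf : Integrable f μ) (N k : ℕ) :
    Integrable (fun x => blockMin (fun n => birkhoffSum T f n x) N k) μ := by
  have : (fun x => blockMin (fun n => birkhoffSum T f n x) N k) =
      (Finset.range (N + 1)).inf' Finset.nonempty_range_add_one (fun j x => birkhoffSum T f (k + j) x) := by
    ext x
    exact (Finset.inf'_apply _ _ _).symm
  rw [this]
  exact Finset.inf'_induction (p := fun g => Integrable g μ) _ _
    (fun a ha b hb => ha.inf hb) (fun j _ => birkhoffSum_integrable hT hf _)

lemma heavy_forward {X : Type*} [MeasurableSpace X] (μ : Measure X) [IsProbabilityMeasure μ]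
    (T : X ≃ X) (hE : Ergodic (⇑T) μ) (f : X → ℝ) (hf : Integrable f μ)
    (h0 : ∫ x, f x ∂μ = 0) (N : ℕ)
    (hz : ∀ᵐ x ∂μ, ∃ i : ℤ, -(N + 1 : ℤ) ≤ i ∧ i ≤ N + 1 ∧ birkhoffZ T f i x < 0) : False := by
  have hT : MeasurePreserving T μ μ := hE.toMeasurePreserving
  set b : X → ℕ → ℝ := fun x k => blockMin (fun n => birkhoffSum T f n x) N k with hb
  set h : X → ℝ := fun x => b x (N + 1) - b x 0 with hh
  have hd : ∀ k x, h (T^[k] x) = b x (k + (N + 1)) - b x k := by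
    intro k x
    simp only [hh, hb]
    rw [blockMin_birkhoff T f N (k + (N + 1)) x, blockMin_birkhoff T f N k x,
      blockMin_birkhoff T f N (N + 1) (T^[k] x), birkhoffSum_add T f k (N + 1),
      ← Function.iterate_add_apply, add_comm (N + 1) k]
    ring
  have hhInt : Integrable h μ :=
    (blockMin_integrable hT hf N (N + 1)).sub (blockMin_integrable hT hf N 0)
  have hzero : ∫ x, h x ∂μ = 0 := by
    have e : h = fun x => birkhoffSum T f (N + 1) x + (b (T^[N + 1] x) 0 - b x 0) := by
      ext x
      simp only [hh, hb]
      rw [blockMin_birkhoff T f N (N + 1) x]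
      ring
    have i0 : Integrable (fun x => b x 0) μ := blockMin_integrable hT hf N 0
    have i1 : Integrable (fun x => b (T^[N + 1] x) 0) μ :=
      (hT.iterate (N + 1)).integrable_comp_of_integrable i0
    have e1 := integral_comp_mp (hT.iterate (N + 1)) i0
    have e2 : ∫ x, birkhoffSum T f (N + 1) x ∂μ = 0 := by
      unfold birkhoffSum
      have hi : ∀ i ∈ Finset.range (N + 1), Integrable (fun x => f (T^[i] x)) μ :=
        fun i _ => (hT.iterate i).integrable_comp_of_integrable hf
      rw [integral_finsetSum _ hi]
      exact Finset.sum_eq_zero fun i _ => by rw [integral_comp_mp (hT.iterate i) hf, h0]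
    have i2 : Integrable (fun x => b (T^[N + 1] x) 0 - b x 0) μ := i1.sub i0
    rw [e, integral_add (birkhoffSum_integrable hT hf _) i2, e2, integral_sub i1 i0, e1]
    simp
  -- a.e. no local minima along the orbit
  have hloc : ∀ᵐ x ∂μ, ∀ m, N + 1 ≤ m → ∃ j, m ≤ j + (N + 1) ∧ j ≤ m + (N + 1) ∧
      birkhoffSum T f j x < birkhoffSum T f m x := by
    have : ∀ᵐ x ∂μ, ∀ m : ℕ, ∃ i : ℤ, -(N + 1 : ℤ) ≤ i ∧ i ≤ N + 1 ∧
        birkhoffZ T f i (T^[m] x) < 0 :=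
      ae_all_iff.2 fun m => (hT.iterate m).quasiMeasurePreserving.ae hz
    filter_upwards [this] with x hx m hm
    obtain ⟨i, h1, h2, h3⟩ := hx m
    refine ⟨((m : ℤ) + i).toNat, by omega, by omega, ?_⟩
    rw [birkhoffZ_iterate T f m ((m : ℤ) + i).toNat i x (by omega)] at h3
    linarith
  set A : Set X := {x | 0 ≤ h x} with hA
  have hAm : NullMeasurableSet A μ := nullMeasurableSet_le aemeasurable_const hhInt.aemeasurable
  have hTN := hT.iterate (N + 1)
  have hstep : ∀ᵐ x ∂μ, T^[N + 1] x ∈ A → 0 < h x := by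
    filter_upwards [hloc] with x hx hxA
    have := hd (N + 1) x
    simp only [hA, Set.mem_ofPred_eq] at hxA
    rw [this] at hxA
    have := block_step (fun n => birkhoffSum T f n x) N 0 hx
      (by simpa [hb, sub_nonneg] using hxA)
    simpa [hh, hb, sub_pos] using this
  have hsub : (T^[N + 1] ⁻¹' A) ≤ᵐ[μ] A := by
    filter_upwards [hstep] with x hx hxA
    exact (hx hxA).le
  have heq : (T^[N + 1] ⁻¹' A) =ᵐ[μ] A :=
    ae_eq_of_ae_subset_of_measure_ge hsub (hTN.measure_preimage hAm).ge
      (hAm.preimage hTN.quasiMeasurePreserving) (measure_ne_top _ _)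
  have hiff : ∀ᵐ x ∂μ, T^[N + 1] x ∈ A ↔ x ∈ A := by
    filter_upwards [heq] with x hx
    exact iff_of_eq hx
  have horb : ∀ᵐ x ∂μ, ∀ k : ℕ, (T^[k + (N + 1)] x ∈ A ↔ T^[k] x ∈ A) ∧
      (T^[k + (N + 1)] x ∈ A → 0 < h (T^[k] x)) := by
    refine ae_all_iff.2 fun k => ?_
    filter_upwards [(hT.iterate k).quasiMeasurePreserving.ae (hiff.and hstep)] with x hx
    rw [add_comm, Function.iterate_add_apply]
    exact hx
  have hpos : ∀ᵐ x ∂μ, x ∈ A → 0 < h x := by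
    filter_upwards [hiff, hstep] with x h1 h2 hx
    exact h2 (h1.2 hx)
  have hinv : A ≤ᵐ[μ] (T ⁻¹' A) := by
    filter_upwards [horb] with x hx hxA
    by_contra hc
    have hpA : ∀ k, T^[k] x ∈ A → 0 < h (T^[k] x) := fun k hk => (hx k).2 ((hx k).1.2 hk)
    have a0 : T^[0] x ∈ A := hxA
    have a1 := (hx 0).1.2 a0
    rw [zero_add] at a1
    have a2 := (hx (N + 1)).1.2 a1
    have p1 := hpA _ a1
    have p2 := hpA _ a2
    have c0 : T^[1] x ∉ A := hc
    have c1 : T^[1 + (N + 1)] x ∉ A := fun hk => c0 ((hx 1).1.1 hk)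
    simp only [hA, Set.mem_ofPred_eq, not_le] at c0 c1
    rw [hd] at p1 p2 c0 c1
    exact block_phase (fun n => birkhoffSum T f n x) N (by linarith) (by linarith)
      (by linarith) (by linarith)
  rcases hE.ae_empty_or_univ_of_ae_le_preimage hAm hinv with hc | hc
  · have hneg : ∀ᵐ x ∂μ, h x < 0 := by
      filter_upwards [hc] with x hx
      by_contra hcc
      exact (iff_of_eq hx).1 (not_lt.1 hcc)
    have e : h =ᵐ[μ] 0 := by
      have := (integral_eq_zero_iff_of_nonneg_ae (f := fun x => - h x) (μ := μ)
        (by filter_upwards [hneg] with x hx; simpa using hx.le) hhInt.neg).1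
        (by rw [integral_neg, hzero, neg_zero])
      filter_upwards [this] with x hx
      simpa using hx
    obtain ⟨x, h1, h2⟩ := (hneg.and e).exists
    simp only [Pi.zero_apply] at h2
    linarith
  · have hp : ∀ᵐ x ∂μ, 0 < h x := by
      filter_upwards [hc, hpos] with x hx hxp
      exact hxp ((iff_of_eq hx).2 trivial)
    have e : h =ᵐ[μ] 0 := (integral_eq_zero_iff_of_nonneg_ae
        (by filter_upwards [hp] with x hx; simpa using hx.le) hhInt).1 hzero
    obtain ⟨x, h1, h2⟩ := (hp.and e).exists
    simp only [Pi.zero_apply] at h2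
    linarith

/-- An invertible measure-preserving transformation of a probability space is ergodic
iff for every integrable mean-zero `f` and all integers `n₁ < n₂`, the set
`H(n₁, n₂)` of points whose two-sided Birkhoff sums are nonnegative for all times in
`[n₁, n₂]` has positive measure. -/
theorem ergodic_iff_twoSided_heavy_pos_measure
    {X : Type*} [MeasurableSpace X] (μ : Measure X) [IsProbabilityMeasure μ]
    (T : X ≃ X) (hT : MeasurePreserving T μ μ) (hT' : MeasurePreserving T.symm μ μ) :
    Ergodic (⇑T) μ ↔
      ∀ (f : X → ℝ), Integrable f μ → (∫ x, f x ∂μ) = 0 →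
        ∀ n₁ n₂ : ℤ, n₁ < n₂ →
          0 < μ {x | ∀ i : ℤ, n₁ ≤ i → i ≤ n₂ → 0 ≤ birkhoffZ T f i x} := by
  constructor
  · intro hE f hf h0 n₁ n₂ _
    rw [pos_iff_ne_zero]
    intro hz
    refine heavy_forward μ T hE f hf h0 (n₁.natAbs + n₂.natAbs) ?_
    have : ∀ᵐ x ∂μ, ¬ ∀ i : ℤ, n₁ ≤ i → i ≤ n₂ → 0 ≤ birkhoffZ T f i x := by
      rw [ae_iff]
      simpa using hz
    filter_upwards [this] with x hx
    push Not at hx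
    obtain ⟨i, h1, h2, h3⟩ := hx
    exact ⟨i, by omega, by omega, h3⟩
  · intro H
    refine ⟨hT, ⟨fun s hs hinv => ?_⟩⟩
    by_contra hc
    have hs0 : μ s ≠ 0 := fun h => hc (by
      rw [Filter.eventuallyConst_set']
      exact Or.inl (ae_eq_empty.2 h))
    have hs1 : μ sᶜ ≠ 0 := fun h => hc (by
      rw [Filter.eventuallyConst_set']
      exact Or.inr (ae_eq_univ.2 h))
    have hr0 : 0 < μ.real s := by
      rw [measureReal_def]; exact ENNReal.toReal_pos hs0 (measure_ne_top _ _)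
    have hr1 : μ.real s < 1 := by
      have h1 : 0 < μ.real sᶜ := by
        rw [measureReal_def]; exact ENNReal.toReal_pos hs1 (measure_ne_top _ _)
      rw [probReal_compl_eq_one_sub hs] at h1
      linarith
    have hi : Integrable (s.indicator (fun _ => (1 : ℝ))) μ :=
      (integrable_const 1).indicator hs
    have key := H (fun x => s.indicator (fun _ => (1 : ℝ)) x - μ.real s)
      (hi.sub (integrable_const _))
      (by rw [integral_sub hi (integrable_const _), integral_indicator_const _ hs]; simp)
      (-1) 1 (by norm_num)
    obtain ⟨x, hx⟩ := nonempty_of_measure_ne_zero key.ne'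
    have h1 := hx 1 (by norm_num) (by norm_num)
    have h2 := hx (-1) (by norm_num) (by norm_num)
    have hsx : T.symm x ∈ s ↔ x ∈ s := by
      conv_lhs => rw [← hinv]
      simp
    change 0 ≤ birkhoffZ T _ (Int.ofNat 1) x at h1
    change 0 ≤ birkhoffZ T _ (Int.negSucc 0) x at h2
    simp only [birkhoffZ, Finset.sum_range_one, zero_add, Finset.Icc_self, Finset.sum_singleton,
      Function.iterate_zero, Function.iterate_one, id] at h1 h2
    by_cases hxs : x ∈ s
    · rw [Set.indicator_of_mem (hsx.2 hxs)] at h2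
      linarith
    · rw [Set.indicator_of_notMem hxs] at h1
      linarith
end

section
/- There exists a set I ⊂ [0,1) that is a finite union of closed intervals, with Lebesgue measure 0 < λ(I) < 1, such that for every x ∈ [0,1) there exists a natural number N ≥ 1 with #{n : 1 ≤ n ≤ N, (n·x mod 1) ∈ I} < N · λ(I). In other words, for no x is the sequence x, 2x, 3x, … (taken modulo 1) heavy for I. -/
open MeasureTheory
open scoped Classical

namespace HeavyAux

/-- Bitmask of the cells `[c/84, (c+1)/84)` used in the construction. -/
def mask : ℕ := 6039907870971565738356796

/-- Cell `j` is used. -/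
def cell (j : ℕ) : Bool := mask.testBit j

/-- Left endpoints. -/
noncomputable def lo (j : Fin 84) : ℝ := (j : ℕ) / 84

/-- Right endpoints (the interval is empty if the cell is not used). -/
noncomputable def hi (j : Fin 84) : ℝ :=
  if cell j then ((j : ℕ) + 99 / 100) / 84 else (j : ℕ) / 84 - 1

/-- The set. -/
noncomputable def J : Set ℝ := ⋃ j : Fin 84, Set.Icc (lo j) (hi j)

set_option maxRecDepth 100000 in
theorem no_triple : ∀ a < 1008, (cell (a / 12 % 84) && cell (a / 6 % 84) &&
    (cell (a / 4 % 84) || cell (a / 3 % 84))) = false := by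
  decide +kernel

theorem mem_J {y : ℝ} : y ∈ J ↔ ∃ j : ℕ, j < 84 ∧ cell j = true ∧ (j : ℝ) ≤ 84 * y ∧
    84 * y ≤ j + 99 / 100 := by
  unfold J
  simp only [Set.mem_iUnion, Set.mem_Icc]
  constructor
  · rintro ⟨j, h1, h2⟩
    unfold lo at h1
    unfold hi at h2
    split_ifs at h2 with h
    · exact ⟨j, j.2, h, by linarith, by linarith⟩
    · linarith
  · rintro ⟨j, hj, hc, h1, h2⟩
    refine ⟨⟨j, hj⟩, ?_, ?_⟩
    · unfold lo
      simp only
      linarith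
    · unfold hi
      simp only [hc, if_true]
      linarith

theorem key {x : ℝ} (hx : 0 ≤ x) (n d : ℕ) (hnd : n * d = 12) (h : Int.fract ((n : ℝ) * x) ∈ J) :
    cell (⌊1008 * x⌋₊ / d % 84) = true := by
  obtain ⟨j, hj, hc, h1, h2⟩ := mem_J.1 h
  have hn0 : (0 : ℝ) ≤ (n : ℝ) * x := by positivity
  have hm : (0 : ℤ) ≤ ⌊(n : ℝ) * x⌋ := Int.floor_nonneg.2 hn0
  obtain ⟨m, hm⟩ := Int.eq_ofNat_of_zero_le hm
  have hf : Int.fract ((n : ℝ) * x) = n * x - m := by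
    rw [Int.fract, hm]; simp
  rw [hf] at h1 h2
  have hd : 0 < d := by
    rcases Nat.eq_zero_or_pos d with h | h
    · subst h; omega
    · exact h
  have hdR : (0 : ℝ) < d := by exact_mod_cast hd
  have hndR : (n : ℝ) * d = 12 := by exact_mod_cast hnd
  have e : 1008 * x = d * (84 * (n * x)) := by
    calc 1008 * x = 84 * 12 * x := by ring
      _ = _ := by rw [← hndR]; ring
  have hq : ⌊1008 * x⌋₊ / d = j + 84 * m := by
    rw [← Nat.floor_div_natCast, Nat.floor_eq_iff (by positivity), e]
    rw [mul_div_cancel_left₀ _ hdR.ne']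
    push_cast
    constructor <;> linarith
  rw [hq]
  have : (j + 84 * m) % 84 = j := by omega
  rw [this]; exact hc

theorem card_cells : ((Finset.univ : Finset (Fin 84)).filter (fun j : Fin 84 => cell (j : ℕ) = true)).card = 43 := by
  simp only [Finset.card_filter]
  decide +kernel

theorem vol : volume J = ENNReal.ofReal (4257 / 8400) := by
  unfold J
  rw [measure_iUnion]
  · rw [tsum_fintype]
    have : ∀ j : Fin 84, volume (Set.Icc (lo j) (hi j)) =
        if cell j = true then ENNReal.ofReal (99 / 8400) else 0 := by
      intro j
      rw [Real.volume_Icc]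
      unfold lo hi
      split_ifs
      · congr 1; ring
      · apply ENNReal.ofReal_of_nonpos; linarith
    simp only [this]
    rw [← Finset.sum_filter, Finset.sum_const, card_cells, ← ENNReal.ofReal_nsmul]
    congr 1
    norm_num
  · intro i j hij
    refine Set.disjoint_left.2 ?_
    intro y hi' hj'
    apply hij
    have aux : ∀ j : Fin 84, y ∈ Set.Icc (lo j) (hi j) → ⌊84 * y⌋₊ = j := by
      rintro j ⟨h1, h2⟩
      unfold lo at h1
      unfold hi at h2
      have : (0 : ℝ) ≤ (j : ℕ) := Nat.cast_nonneg _
      split_ifs at h2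
      · rw [Nat.floor_eq_iff (by linarith)]
        constructor <;> linarith
      · linarith
    exact Fin.ext ((aux i hi').symm.trans (aux j hj'))
  · intro j; exact measurableSet_Icc

/-- The frozen statement coerces the index set `Finset.Icc 1 N` to a finset of reals through
the monadic lift; counting there is the same as counting in `ℕ`. -/
theorem card_eq (s : Finset ℕ) (p : ℝ → Prop) :
    (Finset.filter (fun r : ℝ => p r) (do let a ← s; pure (a : ℝ))).card =
      (Finset.filter (fun n : ℕ => p (n : ℝ)) s).card := by
  have h : (do let a ← s; pure (a : ℝ) : Finset ℝ) = s.image (fun n : ℕ => (n : ℝ)) := by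
    ext r
    simp [Finset.bind_def, Finset.mem_sup, eq_comm]
  rw [h, Finset.filter_image, Finset.card_image_of_injective _ Nat.cast_injective]

end HeavyAux

open HeavyAux in
/-- There is a finite union of closed intervals `I ⊂ [0,1)` of nontrivial Lebesgue
measure such that for no `x` is the sequence `x, 2x, 3x, …` (mod 1) heavy for `I`. -/
theorem exists_interval_union_with_no_heavy_multiples :
    ∃ (I : Set ℝ) (k : ℕ) (a b : Fin k → ℝ),
      I = ⋃ j : Fin k, Set.Icc (a j) (b j) ∧
      I ⊆ Set.Ico (0 : ℝ) 1 ∧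
      0 < volume I ∧ volume I < 1 ∧
      ∀ x ∈ Set.Ico (0 : ℝ) 1, ∃ N : ℕ, 1 ≤ N ∧
        (((Finset.Icc 1 N).filter (fun n => Int.fract ((n : ℝ) * x) ∈ I)).card : ℝ) <
          (N : ℝ) * (volume I).toReal := by
  refine ⟨J, 84, lo, hi, rfl, ?_, ?_, ?_, ?_⟩
  · intro y hy
    obtain ⟨j, hj, -, h1, h2⟩ := mem_J.1 hy
    have h0 : (0 : ℝ) ≤ j := Nat.cast_nonneg _
    have h3 : (j : ℝ) ≤ 83 := by exact_mod_cast (by omega : j ≤ 83)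
    constructor <;> linarith
  · rw [vol]; simp
  · rw [vol, ENNReal.ofReal_lt_one]; norm_num
  · rintro x ⟨hx0, hx1⟩
    rw [vol, ENNReal.toReal_ofReal (by norm_num)]
    have k1 := key hx0 1 12 (by norm_num)
    have k2 := key hx0 2 6 (by norm_num)
    have k3 := key hx0 3 4 (by norm_num)
    have k4 := key hx0 4 3 (by norm_num)
    have ha : ⌊1008 * x⌋₊ < 1008 := by
      rw [Nat.floor_lt (by positivity)]
      push_cast; linarith
    have hno := no_triple _ ha
    have i1 : Finset.Icc 1 1 = ({1} : Finset ℕ) := by decide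
    have i2 : Finset.Icc 1 2 = ({1, 2} : Finset ℕ) := by decide
    have i4 : Finset.Icc 1 4 = ({1, 2, 3, 4} : Finset ℕ) := by decide
    by_cases h1 : Int.fract (((1 : ℕ) : ℝ) * x) ∈ J
    · by_cases h2 : Int.fract (((2 : ℕ) : ℝ) * x) ∈ J
      · have h3 : Int.fract (((3 : ℕ) : ℝ) * x) ∉ J := by
          intro h
          rw [k1 h1, k2 h2, k3 h] at hno
          simp at hno
        have h4 : Int.fract (((4 : ℕ) : ℝ) * x) ∉ J := by
          intro h
          rw [k1 h1, k2 h2, k4 h] at hno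
          simp at hno
        refine ⟨4, by norm_num, ?_⟩
        rw [card_eq, i4, Finset.filter_insert, if_pos h1, Finset.filter_insert, if_pos h2,
          Finset.filter_insert, if_neg h3, Finset.filter_singleton, if_neg h4]
        norm_num
      · refine ⟨2, by norm_num, ?_⟩
        rw [card_eq, i2, Finset.filter_insert, if_pos h1, Finset.filter_singleton, if_neg h2]
        norm_num
    · refine ⟨1, le_rfl, ?_⟩
      rw [card_eq, i1, Finset.filter_singleton, if_neg h1]
      norm_num
end

section
/- Let t : ℕ → {0,1} be the Thue–Morse sequence, i.e., t(n) is the parity of the number of 1's in the binary expansion of n (t = 0,1,1,0,1,0,0,1,…). If k is an index with t(k) = 1 and t(k+1) = 1, then for every natural number N ≥ 1, ∑_{i=0}^{N−1} t(k+i) ≥ N/2. -/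
/-- The Thue–Morse sequence: `thueMorse n` is the parity of the number of ones in the
binary expansion of `n`. -/
def thueMorse (n : ℕ) : ℕ := (Nat.digits 2 n).sum % 2

theorem tm_pair (m : ℕ) : thueMorse (2 * m) + thueMorse (2 * m + 1) = 1 := by
  have hb : Nat.digits 2 (2 * m + 1) = 1 :: Nat.digits 2 m := by
    have := Nat.digits_add_two_add_one 0 (2 * m)
    rw [this]
    congr 1
    · omega
    · congr 1
      omega
  have ha : (Nat.digits 2 (2 * m)).sum = (Nat.digits 2 m).sum := by
    rcases Nat.eq_zero_or_pos m with h | h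
    · subst h; simp
    · rw [Nat.digits_def' (by norm_num) (by omega)]
      simp
  unfold thueMorse
  rw [ha, hb, List.sum_cons]
  omega

theorem tm_odd_sum (m j : ℕ) (h1 : thueMorse (2 * m + 1) = 1) :
    ∑ i ∈ Finset.range (2 * j + 1), thueMorse (2 * m + 1 + i) = j + 1 := by
  induction j with
  | zero => simpa using h1
  | succ j ih =>
    rw [show 2 * (j + 1) + 1 = (2 * j + 1) + 1 + 1 by ring, Finset.sum_range_succ,
      Finset.sum_range_succ, ih]
    have := tm_pair (m + j + 1)
    rw [show 2 * m + 1 + (2 * j + 1) = 2 * (m + j + 1) by ring,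
      show 2 * m + 1 + (2 * j + 1 + 1) = 2 * (m + j + 1) + 1 by ring]
    omega

/-- Any tail of the Thue–Morse sequence starting at an occurrence of the word `11` is
heavy for the symbol `1`: its partial sums of length `N` are at least `N/2`. -/
theorem thueMorse_heavy_of_double_one (k : ℕ)
    (h1 : thueMorse k = 1) (h2 : thueMorse (k + 1) = 1) :
    ∀ N : ℕ, 1 ≤ N →
      (N : ℝ) / 2 ≤ ∑ i ∈ Finset.range N, (thueMorse (k + i) : ℝ) := by
  intro N hN
  have key : N ≤ 2 * ∑ i ∈ Finset.range N, thueMorse (k + i) := by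
    rcases Nat.even_or_odd' k with ⟨m, rfl | rfl⟩
    · have := tm_pair m
      omega
    · rcases Nat.even_or_odd' N with ⟨j, rfl | rfl⟩
      · obtain ⟨j, rfl⟩ : ∃ i, j = i + 1 := ⟨j - 1, by omega⟩
        rw [show 2 * (j + 1) = (2 * j + 1) + 1 by ring, Finset.sum_range_succ,
          tm_odd_sum m j h1]
        omega
      · rw [tm_odd_sum m j h1]
        omega
  have key' : (N : ℝ) ≤ 2 * ∑ i ∈ Finset.range N, (thueMorse (k + i) : ℝ) := by
    exact_mod_cast key
  linarith
end
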